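/- Let q be a prime power and let c be a code word of C_2(3,q) with 3q²−3q−3 ≤ wt(c) ≤ B_{3,q}. Then no 3-secant to supp(c) is contained in q+1 planes of PG(3,q) that are all of the same type T ∈ {T^odd, T^△}. -/

import Mathlib

open scoped Classical

noncomputable section

namespace PGCode

open Projectivization

/-- The points of `PG(n, q)`, where the field `F` has order `q`. -/
abbrev Pt (F : Type) [Field F] (n : ℕ) := Projectivization F (Fin (n + 1) → F)

variable {F : Type} [Field F]

/-- A point of `PG(n,q)` lies in the projective subspace determined by a linear subspace `W`. -/
def ptIn {n : ℕ} (P : Pt F n) (W : Submodule F (Fin (n + 1) → F)) : Prop :=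
  Projectivization.submodule P ≤ W

/-- The set of points of the projective subspace determined by a linear subspace `W`. -/
def ptsIn {n : ℕ} (W : Submodule F (Fin (n + 1) → F)) : Set (Pt F n) :=
  {P | ptIn P W}

/-- The incidence vector (over `F_p = ZMod p`) of the projective subspace determined by `W`. -/
def incVec (p : ℕ) {n : ℕ} (W : Submodule F (Fin (n + 1) → F)) : Pt F n → ZMod p :=
  fun P => if ptIn P W then (1 : ZMod p) else 0

/-- The code `C_{n-1}(n,q)`: the `F_p`-span of the incidence vectors of all hyperplanes
(projective dimension `n-1`, i.e. linear dimension `n`). -/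
def code (F : Type) [Field F] (p n : ℕ) : Submodule (ZMod p) (Pt F n → ZMod p) :=
  Submodule.span (ZMod p)
    {v | ∃ W : Submodule F (Fin (n + 1) → F), Module.finrank F W = n ∧ v = incVec p W}

/-- The support of a word. -/
def supp {p n : ℕ} (v : Pt F n → ZMod p) : Set (Pt F n) := {P | v P ≠ 0}

/-- The weight of a word. -/
def wt {p n : ℕ} (v : Pt F n → ZMod p) : ℕ := (supp v).ncard

/-- The weight of the restriction of a word to the subspace determined by `W`. -/
def wtRes {p n : ℕ} (c : Pt F n → ZMod p) (W : Submodule F (Fin (n + 1) → F)) : ℕ :=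
  (ptsIn W ∩ supp c).ncard

/-- `θ_m = (q^(m+1) - 1)/(q - 1)`, with `θ_m = 0` for `m < 0`. -/
def theta (q : ℕ) (m : ℤ) : ℕ :=
  if m < 0 then 0 else ∑ i ∈ Finset.range (m.toNat + 1), q ^ i

/-- The bound `B_{n,q}` from the paper. -/
def B (n q : ℕ) : ℝ :=
  if q < 7 ∨ q = 8 ∨ q = 9 ∨ q = 16 ∨ q = 25 ∨ q = 27 ∨ q = 49 then
    2 * (q : ℝ) ^ (n - 1)
  else if q = 7 ∨ q = 11 ∨ q = 13 ∨ q = 17 then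
    (3 * q - Real.sqrt (6 * q) - 1 / 2) * (q : ℝ) ^ (n - 2)
  else if q = 19 ∨ q = 121 then
    (3 * q - Real.sqrt (6 * q) + 9 / 2) * (q : ℝ) ^ (n - 2)
  else if q = 29 ∨ q = 31 ∨ q = 32 then
    (4 * q - 4 * Real.sqrt q - 25 / 2) * (q : ℝ) ^ (n - 2)
  else
    (4 * q - Real.sqrt (8 * q) - 33 / 2) * (q : ℝ) ^ (n - 2)

/-- A line of `PG(n,q)`: a linear subspace of dimension `2`. -/
def IsLine {n : ℕ} (l : Submodule F (Fin (n + 1) → F)) : Prop := Module.finrank F l = 2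

/-- A plane of `PG(n,q)`: a linear subspace of dimension `3`. -/
def IsPlane {n : ℕ} (W : Submodule F (Fin (n + 1) → F)) : Prop := Module.finrank F W = 3

/-- The line `l` is an `α`-secant to `supp c`. -/
def secant {p n : ℕ} (c : Pt F n → ZMod p) (l : Submodule F (Fin (n + 1) → F)) (α : ℕ) : Prop :=
  IsLine l ∧ (ptsIn l ∩ supp c).ncard = α

/-- The restriction of `c` to the plane `W` is a linear combination of at most two lines of `W`. -/
def TwoLineComb (p : ℕ) {n : ℕ} (c : Pt F n → ZMod p) (W : Submodule F (Fin (n + 1) → F)) :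
    Prop :=
  ∃ l₁ l₂ : Submodule F (Fin (n + 1) → F), IsLine l₁ ∧ IsLine l₂ ∧ l₁ ≤ W ∧ l₂ ≤ W ∧
    ∃ a b : ZMod p, ∀ P : Pt F n, ptIn P W → c P = a * incVec p l₁ P + b * incVec p l₂ P

/-- Type `T^△`: the restriction of `c` to the plane `W` is a linear combination (with nonzero
coefficients) of three nonconcurrent lines of `W`. -/
def TypeTri (p : ℕ) {n : ℕ} (c : Pt F n → ZMod p) (W : Submodule F (Fin (n + 1) → F)) : Prop :=
  ∃ l₁ l₂ l₃ : Submodule F (Fin (n + 1) → F),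
    IsLine l₁ ∧ IsLine l₂ ∧ IsLine l₃ ∧ l₁ ≤ W ∧ l₂ ≤ W ∧ l₃ ≤ W ∧
    l₁ ≠ l₂ ∧ l₁ ≠ l₃ ∧ l₂ ≠ l₃ ∧
    (¬ ∃ P : Pt F n, ptIn P l₁ ∧ ptIn P l₂ ∧ ptIn P l₃) ∧
    ∃ a₁ a₂ a₃ : ZMod p, a₁ ≠ 0 ∧ a₂ ≠ 0 ∧ a₃ ≠ 0 ∧
      ∀ P : Pt F n, ptIn P W →
        c P = a₁ * incVec p l₁ P + a₂ * incVec p l₂ P + a₃ * incVec p l₃ P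

/-- Type `T^★`: the restriction of `c` to the plane `W` is a linear combination (with nonzero
coefficients) of three distinct concurrent lines of `W`. -/
def TypeStar (p : ℕ) {n : ℕ} (c : Pt F n → ZMod p) (W : Submodule F (Fin (n + 1) → F)) : Prop :=
  ∃ l₁ l₂ l₃ : Submodule F (Fin (n + 1) → F),
    IsLine l₁ ∧ IsLine l₂ ∧ IsLine l₃ ∧ l₁ ≤ W ∧ l₂ ≤ W ∧ l₃ ≤ W ∧
    l₁ ≠ l₂ ∧ l₁ ≠ l₃ ∧ l₂ ≠ l₃ ∧
    (∃ P : Pt F n, ptIn P l₁ ∧ ptIn P l₂ ∧ ptIn P l₃) ∧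
    ∃ a₁ a₂ a₃ : ZMod p, a₁ ≠ 0 ∧ a₂ ≠ 0 ∧ a₃ ≠ 0 ∧
      ∀ P : Pt F n, ptIn P W →
        c P = a₁ * incVec p l₁ P + a₂ * incVec p l₂ P + a₃ * incVec p l₃ P

/-- The base code word `c₀` of the `T^odd` construction on `PG(2,p)`:
`c₀(0,1,a) = a`, `c₀(1,0,b) = b`, `c₀(1,1,c) = -c`, and `c₀ = 0` elsewhere. -/
def oddBase (p : ℕ) [Fact p.Prime] : Pt (ZMod p) 2 → ZMod p := fun P =>
  if P.rep 0 = 0 ∧ P.rep 1 ≠ 0 then P.rep 2 / P.rep 1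
  else if P.rep 1 = 0 ∧ P.rep 0 ≠ 0 then P.rep 2 / P.rep 0
  else if P.rep 0 = P.rep 1 ∧ P.rep 0 ≠ 0 then -(P.rep 2 / P.rep 0)
  else 0

/-- The line `m : X₀ = 0` of `PG(2,p)`. -/
def lineM1 (p : ℕ) [Fact p.Prime] : Submodule (ZMod p) (Fin 3 → ZMod p) :=
  LinearMap.ker (LinearMap.proj 0 : (Fin 3 → ZMod p) →ₗ[ZMod p] ZMod p)

/-- The line `m' : X₁ = 0` of `PG(2,p)`. -/
def lineM2 (p : ℕ) [Fact p.Prime] : Submodule (ZMod p) (Fin 3 → ZMod p) :=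
  LinearMap.ker (LinearMap.proj 1 : (Fin 3 → ZMod p) →ₗ[ZMod p] ZMod p)

/-- The line `m'' : X₀ = X₁` of `PG(2,p)`. -/
def lineM3 (p : ℕ) [Fact p.Prime] : Submodule (ZMod p) (Fin 3 → ZMod p) :=
  LinearMap.ker ((LinearMap.proj 0 : (Fin 3 → ZMod p) →ₗ[ZMod p] ZMod p) - LinearMap.proj 1)

/-- The code word `d = (γ c₀ + λ m + λ' m' + λ'' m'')^π` of the `T^odd` construction, where the
collineation `π` of `PG(2,p)` is the inverse of the homography induced by the linear
equivalence `g`. -/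
def oddWord (p : ℕ) [Fact p.Prime] (g : (Fin 3 → ZMod p) ≃ₗ[ZMod p] (Fin 3 → ZMod p))
    (γ lam lam' lam'' : ZMod p) : Pt (ZMod p) 2 → ZMod p := fun P =>
  γ * oddBase p (Projectivization.map g.toLinearMap g.injective P) +
    lam * incVec p (lineM1 p) (Projectivization.map g.toLinearMap g.injective P) +
    lam' * incVec p (lineM2 p) (Projectivization.map g.toLinearMap g.injective P) +
    lam'' * incVec p (lineM3 p) (Projectivization.map g.toLinearMap g.injective P)

/-- The semilinear embedding of `PG(2,p)` onto the plane of `PG(n,q)` spanned by the linearly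
independent vectors `b 0, b 1, b 2`, relative to the field embedding `σ : F_p → F`. -/
def planeEmbed {n : ℕ} {p : ℕ} [Fact p.Prime] (σ : ZMod p →+* F)
    (b : Fin 3 → (Fin (n + 1) → F)) (hb : LinearIndependent F b) :
    Pt (ZMod p) 2 → Pt F n := fun P =>
  Projectivization.mk F (∑ i, σ (P.rep i) • b i) (by
    intro hzero
    have h0 : ∀ i ∈ Finset.univ, σ (P.rep i) = 0 :=
      linearIndependent_iff'.mp hb Finset.univ (fun i => σ (P.rep i)) hzero
    have h1 : P.rep = 0 := funext fun i => σ.injective (by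
      simp only [Pi.zero_apply, map_zero]; exact h0 i (Finset.mem_univ i))
    exact P.rep_nonzero h1)

/-- Type `T^odd`: this requires `q = p` to be prime (`|F| = p`), and `c` restricted to the plane
`W` (spanned by the frame `b`) must coincide, via a semilinear identification of `W` with
`PG(2,p)`, with a code word `d` of the `T^odd` construction. -/
def TypeOdd (p : ℕ) [Fact p.Prime] [Fintype F] {n : ℕ} (c : Pt F n → ZMod p)
    (W : Submodule F (Fin (n + 1) → F)) : Prop :=
  Fintype.card F = p ∧
  ∃ (σ : ZMod p →+* F) (b : Fin 3 → (Fin (n + 1) → F)) (hb : LinearIndependent F b),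
    Submodule.span F (Set.range b) = W ∧
    ∃ (g : (Fin 3 → ZMod p) ≃ₗ[ZMod p] (Fin 3 → ZMod p)) (γ lam lam' lam'' : ZMod p), γ ≠ 0 ∧
      ∀ Q : Pt (ZMod p) 2, c (planeEmbed σ b hb Q) = oddWord p g γ lam lam' lam'' Q

/-- The list of plane types `T_0, T_{q+1}, T_{2q}, T_{2q+1}, T^odd, T^△, T^★`. -/
inductive PlaneT : Type where
  | T0 | Tq1 | T2q | T2q1 | Todd | Ttri | Tstar
deriving DecidableEq

/-- The restriction of `c` to the plane `W` is a code word of the given type. -/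
def PlaneIsType (p q : ℕ) [Fact p.Prime] [Fintype F] {n : ℕ} (c : Pt F n → ZMod p)
    (W : Submodule F (Fin (n + 1) → F)) : PlaneT → Prop
  | .T0 => TwoLineComb p c W ∧ wtRes c W = 0
  | .Tq1 => TwoLineComb p c W ∧ wtRes c W = q + 1
  | .T2q => TwoLineComb p c W ∧ wtRes c W = 2 * q
  | .T2q1 => TwoLineComb p c W ∧ wtRes c W = 2 * q + 1
  | .Todd => TypeOdd p c W
  | .Ttri => TypeTri p c W
  | .Tstar => TypeStar p c W

/-- The plane `W` is of type `𝒯`. -/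
def TypeT (p q : ℕ) [Fact p.Prime] [Fintype F] {n : ℕ} (c : Pt F n → ZMod p)
    (W : Submodule F (Fin (n + 1) → F)) : Prop :=
  IsPlane W ∧ ∃ t : PlaneT, PlaneIsType p q c W t

/-- The plane `W` is of type `𝒪`. -/
def TypeO (p q : ℕ) [Fact p.Prime] [Fintype F] {n : ℕ} (c : Pt F n → ZMod p)
    (W : Submodule F (Fin (n + 1) → F)) : Prop :=
  IsPlane W ∧ ¬ TypeT p q c W

/-- The restriction of `c` to the `k`-space `Sp` (linear dimension `k+1`) is of type `t`:
there is a `(k-3)`-space `κ ⊆ Sp` on which `c` is a scalar multiple of the all-one function,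
a plane `π ⊆ Sp` of type `t` disjoint from `κ`, and `c P = c (⟨κ, P⟩ ∩ π)` for every point
`P` of `Sp` outside `κ`. -/
def SpaceIsType (p q : ℕ) [Fact p.Prime] [Fintype F] {n : ℕ} (c : Pt F n → ZMod p)
    (Sp : Submodule F (Fin (n + 1) → F)) (k : ℕ) (t : PlaneT) : Prop :=
  Module.finrank F Sp = k + 1 ∧
  ∃ κ : Submodule F (Fin (n + 1) → F), Module.finrank F κ = k - 2 ∧ κ ≤ Sp ∧
    (∃ a : ZMod p, ∀ P : Pt F n, ptIn P κ → c P = a) ∧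
    ∃ π : Submodule F (Fin (n + 1) → F), IsPlane π ∧ π ≤ Sp ∧ π ⊓ κ = ⊥ ∧
      PlaneIsType p q c π t ∧
      ∀ P : Pt F n, ptIn P Sp → ¬ ptIn P κ →
        ∃ Q : Pt F n, ptIn Q π ∧
          Projectivization.submodule Q ≤ κ ⊔ Projectivization.submodule P ∧ c P = c Q

/-- The values of a `T^odd` word on an affine part of its plane. -/
def oddPattern (b₁ b₂ b₃ s₁ s₂ γ y z : F) : F :=
  (if z = s₁ then b₁ + γ / (y - s₂) else 0) + (if y = s₂ then b₂ + γ / (z - s₁) else 0) +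
    (if y - s₂ = z - s₁ then b₃ - γ / (y - s₂) else 0)

theorem oddPattern_swap (b₁ b₂ b₃ s₁ s₂ γ y z : F) :
    oddPattern b₁ b₂ b₃ s₁ s₂ γ y z = oddPattern b₂ b₁ b₃ s₂ s₁ γ z y := by
  unfold oddPattern
  by_cases h : y - s₂ = z - s₁
  · rw [if_pos h, if_pos h.symm, h]; ring
  · rw [if_neg h, if_neg (Ne.symm h)]; ring

section PowerSums

variable [Fintype F]

theorem sum_pow_card_sub_one_eq : ∑ x : F, x ^ (Fintype.card F - 1) = -1 := by
  have h1 : 1 < Fintype.card F := Fintype.one_lt_card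
  have h : ∀ x : F, x ^ (Fintype.card F - 1) = 1 - if x = 0 then 1 else 0 := by
    intro x
    split_ifs with hx
    · rw [hx, zero_pow (by omega), sub_self]
    · rw [FiniteField.pow_card_sub_one_eq_one x hx, sub_zero]
  simp [h]

theorem sum_id_eq_zero (hq : 3 ≤ Fintype.card F) : ∑ x : F, x = 0 := by
  simpa using FiniteField.sum_pow_lt_card_sub_one F 1 (by omega)

theorem sum_inv_eq_zero (hq : 3 ≤ Fintype.card F) : ∑ x : F, x⁻¹ = 0 := by
  rw [← sum_id_eq_zero hq]
  exact Equiv.sum_comp (Equiv.inv F) (fun x => x)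

theorem sum_pow_mul_add_pow {m n : ℕ} (hq : 3 ≤ Fintype.card F) (hn : 1 ≤ n)
    (hmn : m + n = Fintype.card F) (s : F) :
    ∑ y : F, y ^ m * (y + s) ^ n = -(n * s) := by
  obtain ⟨k, rfl⟩ : ∃ k, n = k + 1 := ⟨n - 1, by omega⟩
  simp_rw [add_pow, Finset.mul_sum]
  rw [Finset.sum_comm, Finset.sum_range_succ, Finset.sum_range_succ, Finset.sum_eq_zero]
  · have h1 : ∀ y : F, y ^ m * (y ^ (k + 1) * s ^ (k + 1 - (k + 1)) *
        ((k + 1).choose (k + 1) : F)) = y := by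
      intro y
      simp only [Nat.sub_self, pow_zero, mul_one, Nat.choose_self, Nat.cast_one]
      rw [← pow_add, hmn, FiniteField.pow_card]
    have h2 : ∀ y : F, y ^ m * (y ^ k * s ^ (k + 1 - k) * ((k + 1).choose k : F)) =
        y ^ (Fintype.card F - 1) * ((k + 1 : ℕ) * s) := by
      intro y
      rw [show Fintype.card F - 1 = m + k by omega, pow_add, Nat.choose_succ_self_right,
        show k + 1 - k = 1 by omega]
      ring
    simp_rw [h1, h2]
    rw [← Finset.sum_mul, sum_pow_card_sub_one_eq, sum_id_eq_zero hq]
    ring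
  · intro i hi
    have hi' := Finset.mem_range.mp hi
    have h : ∀ y : F, y ^ m * (y ^ i * s ^ (k + 1 - i) * ((k + 1).choose i : F)) =
        y ^ (m + i) * (s ^ (k + 1 - i) * ((k + 1).choose i : F)) := by
      intro y; rw [pow_add]; ring
    simp_rw [h]
    rw [← Finset.sum_mul, FiniteField.sum_pow_lt_card_sub_one F _ (by omega), zero_mul]

/-- The moments of the incidence function of an affine line `a y + b z + t = 0`. -/
theorem exists_moment_line {m n : ℕ} (hq : 3 ≤ Fintype.card F) (hm : 1 ≤ m) (hn : 1 ≤ n)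
    (hmn : m + n = Fintype.card F) (a b : F) :
    ∃ C : F, ∀ t : F, ∑ y : F, ∑ z : F,
      y ^ m * z ^ n * (1 - (y * a + z * b + t) ^ (Fintype.card F - 1)) = C * t := by
  have key : ∀ x : F, 1 - x ^ (Fintype.card F - 1) = if x = 0 then 1 else 0 := by
    intro x
    split_ifs with hx
    · rw [hx, zero_pow (by omega), sub_zero]
    · rw [FiniteField.pow_card_sub_one_eq_one x hx, sub_self]
  have hzero : ∀ k, k ≠ Fintype.card F - 1 → k < Fintype.card F → ∑ y : F, y ^ k = 0 :=
    fun k h1 h2 => FiniteField.sum_pow_lt_card_sub_one F _ (by omega)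
  simp_rw [key]
  by_cases hb : b = 0
  · by_cases ha : a = 0
    · refine ⟨0, fun t => ?_⟩
      simp_rw [ha, hb, mul_zero, zero_add, ← Finset.sum_mul, ← Finset.mul_sum]
      by_cases h : m = Fintype.card F - 1
      · rw [hzero n (by omega) (by omega)]; simp
      · simp_rw [← Finset.sum_mul]
        rw [hzero m h (by omega)]; simp
    · have hpt : ∀ t y z : F, (y * a + z * b + t = 0) ↔ (y = -t / a) := by
        intro t y z
        rw [hb, eq_div_iff ha]
        constructor <;> intro h <;> linear_combination h
      simp_rw [hpt]
      rw [exists_congr fun C => forall_congr' fun t => by rw [Finset.sum_comm]]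
      simp only [mul_ite, mul_one, mul_zero, Finset.sum_ite_eq', Finset.mem_univ, if_true]
      simp_rw [← Finset.mul_sum]
      by_cases h : n = Fintype.card F - 1
      · refine ⟨a⁻¹, fun t => ?_⟩
        rw [h, sum_pow_card_sub_one_eq, show m = 1 by omega]
        field_simp
      · exact ⟨0, fun t => by rw [hzero n h (by omega)]; ring⟩
  · have hpt : ∀ t y z : F, (y * a + z * b + t = 0) ↔ (z = -(y * a + t) / b) := by
      intro t y z
      rw [eq_div_iff hb]
      constructor <;> intro h <;> linear_combination h
    simp_rw [hpt]
    simp only [mul_ite, mul_one, mul_zero, Finset.sum_ite_eq', Finset.mem_univ, if_true]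
    by_cases ha : a = 0
    · simp_rw [ha, mul_zero, zero_add, ← Finset.sum_mul]
      by_cases h : m = Fintype.card F - 1
      · refine ⟨b⁻¹, fun t => ?_⟩
        rw [h, sum_pow_card_sub_one_eq, show n = 1 by omega]
        field_simp
      · exact ⟨0, fun t => by rw [hzero m h (by omega)]; ring⟩
    · refine ⟨(-a / b) ^ n * -(n / a), fun t => ?_⟩
      have h : ∀ y : F, y ^ m * (-(y * a + t) / b) ^ n =
          (-a / b) ^ n * (y ^ m * (y + t / a) ^ n) := by
        intro y
        rw [show -(y * a + t) / b = (-a / b) * (y + t / a) by field_simp, mul_pow]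
        ring
      simp_rw [h]
      rw [← Finset.mul_sum, sum_pow_mul_add_pow hq hn hmn]
      ring

theorem triangle_moment {m n : ℕ} (hq : 3 ≤ Fintype.card F) (hm : 1 ≤ m)
    (hmn : m + n = Fintype.card F) (b₁ b₂ b₃ s₁ s₂ s₃ : F) :
    ∑ y : F, ∑ z : F, y ^ m * z ^ n * ((if z = s₁ then b₁ else 0) +
      (if y = s₂ then b₂ else 0) + (if y - z = s₃ then b₃ else 0)) =
    b₁ * s₁ ^ n * (∑ y : F, y ^ m) + b₂ * s₂ ^ m * (∑ z : F, z ^ n) - b₃ * (m * s₃) := by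
  simp_rw [mul_add, Finset.sum_add_distrib]
  have h3 : ∀ y z : F, (y - z = s₃) ↔ (y = z + s₃) := fun y z => sub_eq_iff_eq_add'
  have e1 : ∑ y : F, ∑ z : F, y ^ m * z ^ n * (if z = s₁ then b₁ else 0) =
      b₁ * s₁ ^ n * (∑ y : F, y ^ m) := by
    simp only [mul_ite, mul_zero, Finset.sum_ite_eq', Finset.mem_univ, if_true, Finset.mul_sum]
    exact Finset.sum_congr rfl fun y _ => by ring
  have e2 : ∑ y : F, ∑ z : F, y ^ m * z ^ n * (if y = s₂ then b₂ else 0) =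
      b₂ * s₂ ^ m * (∑ z : F, z ^ n) := by
    rw [Finset.sum_comm]
    simp only [mul_ite, mul_zero, Finset.sum_ite_eq', Finset.mem_univ, if_true, Finset.mul_sum]
    exact Finset.sum_congr rfl fun y _ => by ring
  have e3 : ∑ y : F, ∑ z : F, y ^ m * z ^ n * (if y - z = s₃ then b₃ else 0) =
      - (b₃ * (m * s₃)) := by
    rw [Finset.sum_comm]
    simp_rw [h3]
    simp only [mul_ite, mul_zero, Finset.sum_ite_eq', Finset.mem_univ, if_true]
    rw [← Finset.sum_mul]
    have : ∀ z : F, (z + s₃) ^ m * z ^ n = z ^ n * (z + s₃) ^ m := fun z => mul_comm _ _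
    simp_rw [this]
    rw [sum_pow_mul_add_pow hq hm (by omega)]
    ring
  rw [e1, e2, e3]
  ring

theorem odd_moment (hq : 5 ≤ Fintype.card F) (b₁ b₂ b₃ s₁ s₂ γ : F) :
    ∑ y : F, ∑ z : F, y ^ 2 * z ^ (Fintype.card F - 2) * oddPattern b₁ b₂ b₃ s₁ s₂ γ y z =
      γ - 2 * b₃ * (s₂ - s₁) := by
  have hS : ∀ k, k < Fintype.card F - 1 → ∑ y : F, y ^ k = 0 :=
    fun k h => FiniteField.sum_pow_lt_card_sub_one F _ h
  simp_rw [oddPattern, mul_add, Finset.sum_add_distrib]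
  have h3 : ∀ y z : F, (y - s₂ = z - s₁) ↔ (y = z + (s₂ - s₁)) := fun y z => by
    constructor <;> intro h <;> linear_combination h
  have hinv : ∑ y : F, (y - s₂)⁻¹ = 0 :=
    (Equiv.sum_comp (Equiv.subRight s₂) (fun x => x⁻¹)).trans (sum_inv_eq_zero (by omega))
  have e1 : ∑ y : F, ∑ z : F, y ^ 2 * z ^ (Fintype.card F - 2) *
      (if z = s₁ then b₁ + γ / (y - s₂) else 0) =
      -(2 * γ * s₂ * s₁ ^ (Fintype.card F - 2)) := by
    simp only [mul_ite, mul_zero, Finset.sum_ite_eq', Finset.mem_univ, if_true]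
    have : ∀ y : F, y ^ 2 * s₁ ^ (Fintype.card F - 2) * (b₁ + γ / (y - s₂)) =
        s₁ ^ (Fintype.card F - 2) * (b₁ * y ^ 2 + γ * (y + s₂ * y ^ 0 + s₂ ^ 2 * (y - s₂)⁻¹
          - if y = s₂ then 2 * s₂ else 0)) := by
      intro y
      split_ifs with h
      · rw [h, sub_self]; simp; ring
      · have : y - s₂ ≠ 0 := sub_ne_zero.mpr h
        field_simp
        ring
    simp_rw [this]
    rw [← Finset.mul_sum, Finset.sum_add_distrib, ← Finset.mul_sum, ← Finset.mul_sum,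
      Finset.sum_sub_distrib, Finset.sum_add_distrib, Finset.sum_add_distrib, ← Finset.mul_sum,
      ← Finset.mul_sum, hS 2 (by omega), hS 0 (by omega), sum_id_eq_zero (by omega),
      hinv]
    simp only [Finset.sum_ite_eq', Finset.mem_univ, if_true]
    ring
  have e2 : ∑ y : F, ∑ z : F, y ^ 2 * z ^ (Fintype.card F - 2) *
      (if y = s₂ then b₂ + γ / (z - s₁) else 0) =
      ∑ z : F, s₂ ^ 2 * z ^ (Fintype.card F - 2) * (b₂ + γ / (z - s₁)) := by
    rw [Finset.sum_comm]
    simp only [mul_ite, mul_zero, Finset.sum_ite_eq', Finset.mem_univ, if_true]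
  have e3 : ∑ y : F, ∑ z : F, y ^ 2 * z ^ (Fintype.card F - 2) *
      (if y - s₂ = z - s₁ then b₃ - γ / (y - s₂) else 0) =
      ∑ z : F, (z + (s₂ - s₁)) ^ 2 * z ^ (Fintype.card F - 2) * (b₃ - γ / (z - s₁)) := by
    rw [Finset.sum_comm]
    simp_rw [h3]
    simp only [mul_ite, mul_zero, Finset.sum_ite_eq', Finset.mem_univ, if_true]
    exact Finset.sum_congr rfl fun z _ => by
      rw [show z + (s₂ - s₁) - s₂ = z - s₁ by ring]
  rw [e1, e2, e3, add_assoc, ← Finset.sum_add_distrib]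
  have : ∀ z : F, s₂ ^ 2 * z ^ (Fintype.card F - 2) * (b₂ + γ / (z - s₁)) +
      (z + (s₂ - s₁)) ^ 2 * z ^ (Fintype.card F - 2) * (b₃ - γ / (z - s₁)) =
      (s₂ ^ 2 * b₂ + γ * (s₁ - 2 * s₂)) * z ^ (Fintype.card F - 2) +
      b₃ * (z ^ (Fintype.card F - 2) * (z + (s₂ - s₁)) ^ 2) - γ * z ^ (Fintype.card F - 1) +
      (if z = s₁ then 2 * γ * s₂ * z ^ (Fintype.card F - 2) else 0) := by
    intro z
    rw [show Fintype.card F - 1 = Fintype.card F - 2 + 1 by omega, pow_succ]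
    split_ifs with h
    · rw [h, sub_self]; simp; ring
    · have : z - s₁ ≠ 0 := sub_ne_zero.mpr h
      field_simp
      ring
  simp_rw [this]
  rw [Finset.sum_add_distrib, Finset.sum_sub_distrib, Finset.sum_add_distrib, ← Finset.mul_sum,
    ← Finset.mul_sum, ← Finset.mul_sum, hS _ (by omega), sum_pow_card_sub_one_eq,
    sum_pow_mul_add_pow (by omega) (by omega) (by omega)]
  simp only [Finset.sum_ite_eq', Finset.mem_univ, if_true]
  push_cast
  ring

end PowerSums

section Lifting

/-- A word, viewed as a function on vectors with values in `F`. -/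
def liftVec {p n : ℕ} (ι : ZMod p →+* F) (c : Pt F n → ZMod p) (v : Fin (n + 1) → F) : F :=
  if h : v = 0 then 0 else ι (c (mk F v h))

theorem liftVec_of_ne {p n : ℕ} (ι : ZMod p →+* F) (c : Pt F n → ZMod p)
    {v : Fin (n + 1) → F} (h : v ≠ 0) : liftVec ι c v = ι (c (mk F v h)) := dif_neg h

theorem ptIn_mk {n : ℕ} {v : Fin (n + 1) → F} (h : v ≠ 0) (W : Submodule F (Fin (n + 1) → F)) :
    ptIn (mk F v h) W ↔ v ∈ W := by
  rw [ptIn, submodule_mk, Submodule.span_singleton_le_iff_mem]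

theorem exists_functional_of_finrank {V : Type*} [AddCommGroup V] [Module F V]
    [FiniteDimensional F V] {L W : Submodule F V} (hLW : L ≤ W)
    (h : Module.finrank F W = Module.finrank F L + 1) :
    ∃ φ : V →ₗ[F] F, ∀ v ∈ W, φ v = 0 ↔ v ∈ L := by
  have hlt : L < W := lt_of_le_of_ne hLW (by rintro rfl; omega)
  obtain ⟨w, hw, hwL⟩ := SetLike.exists_of_lt hlt
  obtain ⟨φ, hφw, hφ⟩ := Submodule.exists_le_ker_of_notMem hwL
  refine ⟨φ, fun v hv => ⟨fun h0 => ?_, fun hvL => hφ hvL⟩⟩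
  have hsup : L ⊔ F ∙ w = W := by
    refine Submodule.eq_of_le_of_finrank_le
      (sup_le hLW ((Submodule.span_singleton_le_iff_mem _ _).mpr hw)) ?_
    rw [h]
    refine Nat.succ_le_of_lt (Submodule.finrank_lt_finrank_of_lt (lt_of_le_of_ne le_sup_left ?_))
    intro heq
    exact hwL (heq ▸ Submodule.mem_sup_right (Submodule.mem_span_singleton_self w))
  rw [← hsup] at hv
  obtain ⟨a, ha, b, hb, rfl⟩ := Submodule.mem_sup.mp hv
  obtain ⟨t, rfl⟩ := Submodule.mem_span_singleton.mp hb
  have hφa : φ a = 0 := hφ ha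
  rw [map_add, map_smul, hφa, zero_add, smul_eq_mul] at h0
  rcases mul_eq_zero.mp h0 with rfl | h0
  · simpa using ha
  · exact absurd h0 hφw

/-- The values of `f` on `W` are those of a combination of three nonconcurrent lines. -/
structure TriangleOn {V : Type*} [AddCommGroup V] [Module F V] (f : V → F) (W : Submodule F V)
    (φ : Fin 3 → V →ₗ[F] F) (a : Fin 3 → F) : Prop where
  ne_zero : ∀ i, a i ≠ 0
  joint : ∀ v ∈ W, (∀ i, φ i v = 0) → v = 0
  eq : ∀ v ∈ W, v ≠ 0 → f v = ∑ i, if φ i v = 0 then a i else 0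

/-- The values of `f` on `W` are those of a `T^odd` word, in a form that is symmetric in its
three concurrent lines. -/
structure OddOn {V : Type*} [AddCommGroup V] [Module F V] (f : V → F) (W : Submodule F V)
    (U₁ U₂ U₃ Z : V →ₗ[F] F) (a₁ a₂ a₃ : F) : Prop where
  sum_zero : ∀ v, U₁ v + U₂ v + U₃ v = 0
  joint : ∀ v ∈ W, U₁ v = 0 → U₂ v = 0 → Z v = 0 → v = 0
  eq : ∀ v ∈ W, v ≠ 0 → f v = (if U₁ v = 0 then Z v / U₂ v + a₁ else 0) +
    (if U₂ v = 0 then Z v / U₃ v + a₂ else 0) + (if U₃ v = 0 then Z v / U₁ v + a₃ else 0)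

theorem TypeTri.exists_triangleOn {p n : ℕ} [Fact p.Prime] (ι : ZMod p →+* F)
    {c : Pt F n → ZMod p} {W : Submodule F (Fin (n + 1) → F)} (hW : IsPlane W)
    (h : TypeTri p c W) : ∃ φ a, TriangleOn (liftVec ι c) W φ a := by
  obtain ⟨l₁, l₂, l₃, h₁, h₂, h₃, hl₁, hl₂, hl₃, -, -, -, hP, a₁, a₂, a₃, ha₁, ha₂, ha₃, hc⟩ := h
  rw [IsLine] at h₁ h₂ h₃
  rw [IsPlane] at hW
  obtain ⟨φ₁, hφ₁⟩ := exists_functional_of_finrank hl₁ (by omega)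
  obtain ⟨φ₂, hφ₂⟩ := exists_functional_of_finrank hl₂ (by omega)
  obtain ⟨φ₃, hφ₃⟩ := exists_functional_of_finrank hl₃ (by omega)
  refine ⟨![φ₁, φ₂, φ₃], ![ι a₁, ι a₂, ι a₃], ?_, ?_, ?_⟩
  · intro i
    fin_cases i <;> simpa
  · intro v hv h
    by_contra hv0
    have h1 := h 0
    have h2 := h 1
    have h3 := h 2
    simp only [Matrix.cons_val_zero, Matrix.cons_val_one, Matrix.cons_val] at h1 h2 h3
    refine hP ⟨mk F v hv0, ?_, ?_, ?_⟩ <;> rw [ptIn_mk]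
    exacts [(hφ₁ v hv).mp h1, (hφ₂ v hv).mp h2, (hφ₃ v hv).mp h3]
  · intro v hv hv0
    rw [liftVec_of_ne ι c hv0, hc _ ((ptIn_mk hv0 W).mpr hv), Fin.sum_univ_three]
    simp only [incVec, ptIn_mk, ← hφ₁ v hv, ← hφ₂ v hv, ← hφ₃ v hv, map_add, map_mul]
    by_cases h1 : φ₁ v = 0 <;> by_cases h2 : φ₂ v = 0 <;> by_cases h3 : φ₃ v = 0 <;>
      simp [h1, h2, h3]

theorem incVec_mk {n : ℕ} (p : ℕ) {v : Fin (n + 1) → F} (h : v ≠ 0)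
    (W : Submodule F (Fin (n + 1) → F)) : incVec p W (mk F v h) = if v ∈ W then 1 else 0 := by
  simp only [incVec, ptIn_mk]

theorem oddBase_mk (p : ℕ) [Fact p.Prime] {w : Fin 3 → ZMod p} (hw : w ≠ 0) :
    oddBase p (mk (ZMod p) w hw) = (if w 0 = 0 then w 2 / w 1 else 0) +
      (if w 1 = 0 then w 2 / w 0 else 0) - (if w 0 = w 1 then w 2 / w 0 else 0) := by
  obtain ⟨u, hu⟩ := exists_smul_eq_mk_rep (ZMod p) w hw
  have hu0 : (u : ZMod p) ≠ 0 := u.ne_zero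
  have hr : ∀ i, (mk (ZMod p) w hw).rep i = u * w i := by
    intro i; rw [← hu]; rfl
  simp only [oddBase, hr, mul_eq_zero, hu0, false_or, mul_right_inj' hu0, ne_eq,
    mul_div_mul_left _ _ hu0]
  by_cases h0 : w 0 = 0 <;> by_cases h1 : w 1 = 0
  · simp [h0, h1]
  · simp [h0, h1, Ne.symm h1]
  · simp [h0, h1]
  · by_cases h : w 0 = w 1
    · simp [h, h1]
    · simp [h0, h1, h]

theorem TypeOdd.exists_oddOn [Fintype F] {p n : ℕ} [Fact p.Prime] (ι : ZMod p →+* F)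
    {c : Pt F n → ZMod p} {W : Submodule F (Fin (n + 1) → F)}
    (h : TypeOdd p c W) :
    ∃ U₁ U₂ U₃ Z a₁ a₂ a₃, OddOn (liftVec ι c) W U₁ U₂ U₃ Z a₁ a₂ a₃ := by
  obtain ⟨hcard, σ, b, hb, hspan, g, γ, a₁, a₂, a₃, hγ, hc⟩ := h
  have hσ : ι = σ := Subsingleton.elim _ _
  subst hσ
  have hbij : Function.Bijective ι :=
    (Fintype.bijective_iff_injective_and_card ι).mpr ⟨ι.injective, by rw [hcard, ZMod.card]⟩
  obtain ⟨coord, hcoord⟩ := LinearMap.exists_leftInverse_of_injective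
    (Fintype.linearCombination F b) (LinearMap.ker_eq_bot.mpr hb.fintypeLinearCombination_injective)
  have hrep : ∀ v ∈ W, v = ∑ i, coord v i • b i := by
    intro v hv
    rw [← hspan, ← Fintype.range_linearCombination] at hv
    obtain ⟨t, rfl⟩ := hv
    have : coord (Fintype.linearCombination F b t) = t := LinearMap.congr_fun hcoord t
    rw [this, Fintype.linearCombination_apply]
  set M := (LinearMap.toMatrix' g.toLinearMap).map ι with hM
  set G : (Fin (n + 1) → F) →ₗ[F] (Fin 3 → F) := Matrix.toLin' M ∘ₗ coord with hG
  have hGv : ∀ v τ, coord v = ι ∘ τ → ∀ k, G v k = ι (g τ k) := by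
    intro v τ hτ k
    have : g τ = (LinearMap.toMatrix' g.toLinearMap).mulVec τ := by
      rw [LinearMap.toMatrix'_mulVec]; rfl
    rw [this, RingHom.map_mulVec, hG, LinearMap.comp_apply, hτ, Matrix.toLin'_apply, hM]
  have hlift : ∀ v, ∃ τ : Fin 3 → ZMod p, coord v = ι ∘ τ := by
    intro v
    choose τ hτ using fun i => hbij.2 (coord v i)
    exact ⟨τ, funext fun i => (hτ i).symm⟩
  have hι0 : ∀ x, ι x = 0 ↔ x = 0 := fun x => map_eq_zero ι
  refine ⟨LinearMap.proj 0 ∘ₗ G, -(LinearMap.proj 1 ∘ₗ G),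
    LinearMap.proj 1 ∘ₗ G - LinearMap.proj 0 ∘ₗ G, (-ι γ) • (LinearMap.proj 2 ∘ₗ G),
    ι a₁, ι a₂, ι a₃, ?_, ?_, ?_⟩
  · intro v
    simp only [LinearMap.comp_apply, LinearMap.proj_apply, LinearMap.neg_apply,
      LinearMap.sub_apply]
    ring
  · intro v hv h0 h1 h2
    obtain ⟨τ, hτ⟩ := hlift v
    simp only [LinearMap.comp_apply, LinearMap.proj_apply, LinearMap.neg_apply, neg_eq_zero,
      LinearMap.smul_apply, smul_eq_mul, mul_eq_zero, hGv v τ hτ, hι0, hγ, false_or] at h0 h1 h2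
    have hg : g τ = 0 := by
      funext i
      fin_cases i
      exacts [h0, h1, h2]
    have hτ0 : τ = 0 := by simpa using hg
    rw [hrep v hv, hτ, hτ0]
    simp
  · intro v hv hv0
    obtain ⟨τ, hτ⟩ := hlift v
    have hτ0 : τ ≠ 0 := by
      rintro rfl
      apply hv0
      rw [hrep v hv, hτ]
      simp
    have hgτ : g τ ≠ 0 := by simpa using hτ0
    have hpt : planeEmbed ι b hb (mk (ZMod p) τ hτ0) = mk F v hv0 := by
      obtain ⟨u, hu⟩ := exists_smul_eq_mk_rep (ZMod p) τ hτ0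
      rw [planeEmbed, mk_eq_mk_iff']
      refine ⟨ι u, ?_⟩
      conv_lhs => rw [hrep v hv, hτ]
      rw [← hu, Finset.smul_sum]
      refine Finset.sum_congr rfl fun i _ => ?_
      simp [Units.smul_def, mul_smul]
    have hval := hc (mk (ZMod p) τ hτ0)
    rw [hpt] at hval
    have hmap : Projectivization.map g.toLinearMap g.injective (mk (ZMod p) τ hτ0) =
        mk (ZMod p) (g τ) hgτ := rfl
    rw [liftVec_of_ne _ _ hv0, hval, oddWord, hmap, oddBase_mk, incVec_mk, incVec_mk, incVec_mk]
    simp only [LinearMap.comp_apply, LinearMap.proj_apply, LinearMap.neg_apply, neg_eq_zero,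
      LinearMap.smul_apply, smul_eq_mul, LinearMap.sub_apply, hGv v τ hτ, hι0, lineM1, lineM2,
      lineM3, LinearMap.mem_ker, sub_eq_zero, ι.injective.eq_iff, map_add, map_mul, map_sub,
      apply_ite ι, map_div₀, map_zero, map_one]
    by_cases h0 : g τ 0 = 0 <;> by_cases h1 : g τ 1 = 0
    · simp [h0, h1]
    · simp [h0, h1, Ne.symm h1]; ring
    · simp [h0, h1, Ne.symm h0]; ring
    · by_cases h : g τ 0 = g τ 1
      · simp [h, h1]; ring
      · simp [h0, h1, h, Ne.symm h]

/-- Off the origin, a code word is a combination of the polynomials of degree `q - 1` of the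
hyperplanes. -/
theorem exists_span_of_mem_code [Fintype F] {p n : ℕ} (ι : ZMod p →+* F) {c : Pt F n → ZMod p}
    (hc : c ∈ code F p n) :
    ∃ g ∈ Submodule.span F {g : (Fin (n + 1) → F) → F | ∃ φ : (Fin (n + 1) → F) →ₗ[F] F,
      g = fun v => 1 - φ v ^ (Fintype.card F - 1)}, ∀ v, v ≠ 0 → liftVec ι c v = g v := by
  induction hc using Submodule.span_induction with
  | mem c hc =>
    obtain ⟨W, hW, rfl⟩ := hc
    obtain ⟨φ, hφ⟩ := exists_functional_of_finrank (le_top : W ≤ ⊤) (by simp [hW])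
    refine ⟨_, Submodule.subset_span ⟨φ, rfl⟩, fun v hv => ?_⟩
    have h1 : 1 < Fintype.card F := Fintype.one_lt_card
    rw [liftVec_of_ne _ _ hv, incVec_mk]
    simp only [← hφ v trivial]
    split_ifs with h
    · rw [h, zero_pow (by omega), sub_zero, map_one]
    · rw [FiniteField.pow_card_sub_one_eq_one _ h, sub_self, map_zero]
  | zero => exact ⟨0, zero_mem _, fun v hv => by simp [liftVec_of_ne _ _ hv]⟩
  | add c d _ _ hc hd =>
    obtain ⟨g, hg, hcg⟩ := hc
    obtain ⟨k, hk, hdk⟩ := hd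
    refine ⟨g + k, add_mem hg hk, fun v hv => ?_⟩
    rw [Pi.add_apply, ← hcg v hv, ← hdk v hv]
    simp [liftVec_of_ne _ _ hv]
  | smul a c _ hc =>
    obtain ⟨g, hg, hcg⟩ := hc
    refine ⟨ι a • g, Submodule.smul_mem _ _ hg, fun v hv => ?_⟩
    rw [Pi.smul_apply, ← hcg v hv]
    simp [liftVec_of_ne _ _ hv]

/-- A frame of a `3`-secant: the points of the support are `e₁`, `e₂` and `e₁ + e₂`. -/
structure SecantFrame {V : Type*} [AddCommGroup V] [Module F V] (f : V → F) (l : Submodule F V)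
    (e₁ e₂ : V) : Prop where
  mem₁ : e₁ ∈ l
  mem₂ : e₂ ∈ l
  indep : ∀ y z : F, y • e₁ + z • e₂ = 0 → y = 0 ∧ z = 0
  eq_zero_iff : ∀ y z : F, (y ≠ 0 ∨ z ≠ 0) →
    (f (y • e₁ + z • e₂) = 0 ↔ y ≠ 0 ∧ z ≠ 0 ∧ y ≠ z)

theorem secant.exists_frame {p n : ℕ} [Fact p.Prime] (ι : ZMod p →+* F) {c : Pt F n → ZMod p}
    {l : Submodule F (Fin (n + 1) → F)} (h : secant c l 3) :
    ∃ e₁ e₂, SecantFrame (liftVec ι c) l e₁ e₂ := by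
  obtain ⟨hl, h3⟩ := h
  obtain ⟨A, B', C, hAB, hAC, hBC, hS⟩ := Set.ncard_eq_three.mp h3
  have hmem : ∀ P, P ∈ ptsIn l ∩ supp c ↔ P = A ∨ P = B' ∨ P = C := by
    intro P; rw [hS]; simp
  induction A using Projectivization.ind with | h u hu => ?_
  induction B' using Projectivization.ind with | h v hv => ?_
  induction C using Projectivization.ind with | h w hw => ?_
  have hul : u ∈ l := (ptIn_mk hu l).mp ((hmem _).mpr (Or.inl rfl)).1
  have hvl : v ∈ l := (ptIn_mk hv l).mp ((hmem _).mpr (Or.inr (Or.inl rfl))).1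
  have hwl : w ∈ l := (ptIn_mk hw l).mp ((hmem _).mpr (Or.inr (Or.inr rfl))).1
  simp only [ne_eq, mk_eq_mk_iff'] at hAB hAC hBC hmem
  have hind : ∀ y z : F, y • u + z • v = 0 → y = 0 ∧ z = 0 := by
    intro y z h
    have hy : y = 0 := by
      by_contra hy
      refine hAB ⟨-(z / y), ?_⟩
      have : y • u = -(z • v) := eq_neg_of_add_eq_zero_left h
      rw [neg_smul, div_eq_inv_mul, mul_smul, ← smul_neg, ← this, smul_smul, inv_mul_cancel₀ hy,
        one_smul]
    refine ⟨hy, ?_⟩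
    rw [hy, zero_smul, zero_add] at h
    exact (smul_eq_zero.mp h).resolve_right hv
  have hspan : Submodule.span F {u, v} = l := by
    refine Submodule.eq_of_le_of_finrank_le (Submodule.span_le.mpr ?_) ?_
    · rintro x (rfl | rfl)
      exacts [hul, hvl]
    · rw [show Module.finrank F l = 2 from hl]
      have hli : LinearIndependent F ![u, v] := LinearIndependent.pair_iff.mpr hind
      have := finrank_span_eq_card hli
      rw [Matrix.range_cons_cons_empty, Fintype.card_fin] at this
      rw [this]
  have hw' := hwl
  rw [← hspan] at hw'
  obtain ⟨α, β, rfl⟩ := Submodule.mem_span_pair.mp hw'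
  have hα : α ≠ 0 := by
    rintro rfl
    by_cases hβ : β = 0
    · exact hw (by simp [hβ])
    · exact hBC ⟨β⁻¹, by simp [smul_smul, inv_mul_cancel₀ hβ]⟩
  have hβ : β ≠ 0 := by
    rintro rfl
    exact hAC ⟨α⁻¹, by simp [smul_smul, inv_mul_cancel₀ hα]⟩
  have hind' : ∀ y z : F, y • α • u + z • β • v = 0 → y = 0 ∧ z = 0 := by
    intro y z h
    rw [smul_smul, smul_smul] at h
    have := hind _ _ h
    simpa [hα, hβ] using this
  refine ⟨α • u, β • v, l.smul_mem _ hul, l.smul_mem _ hvl, hind', fun y z hyz => ?_⟩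
  have hne : y • α • u + z • β • v ≠ 0 := by
    intro h
    obtain ⟨hy, hz⟩ := hind' y z h
    exact hyz.elim (absurd hy) (absurd hz)
  have hxl : y • α • u + z • β • v ∈ l :=
    l.add_mem (l.smul_mem _ (l.smul_mem _ hul)) (l.smul_mem _ (l.smul_mem _ hvl))
  have key := hmem (mk F _ hne)
  have hcoef : ∀ y z y' z' : F, y • u + z • v = y' • u + z' • v ↔ y = y' ∧ z = z' := by
    intro y z y' z'
    constructor
    · intro h
      have := hind (y - y') (z - z') (by
        rw [sub_smul, sub_smul]
        rw [← sub_eq_zero] at h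
        rw [← h]
        module)
      exact ⟨sub_eq_zero.mp this.1, sub_eq_zero.mp this.2⟩
    · rintro ⟨rfl, rfl⟩; rfl
  have k1 : (∃ a : F, a • u = y • α • u + z • β • v) ↔ z = 0 := by
    constructor
    · rintro ⟨a, ha⟩
      have := (hcoef a 0 (y * α) (z * β)).mp (by simpa [mul_smul] using ha)
      exact (mul_eq_zero.mp this.2.symm).resolve_right hβ
    · rintro rfl
      exact ⟨y * α, by simp [mul_smul]⟩
  have k2 : (∃ a : F, a • v = y • α • u + z • β • v) ↔ y = 0 := by
    constructor
    · rintro ⟨a, ha⟩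
      have := (hcoef 0 a (y * α) (z * β)).mp (by simpa [mul_smul] using ha)
      exact (mul_eq_zero.mp this.1.symm).resolve_right hα
    · rintro rfl
      exact ⟨z * β, by simp [mul_smul]⟩
  have k3 : (∃ a : F, a • (α • u + β • v) = y • α • u + z • β • v) ↔ y = z := by
    constructor
    · rintro ⟨a, ha⟩
      have := (hcoef (a * α) (a * β) (y * α) (z * β)).mp
        (by simpa [mul_smul, smul_add] using ha)
      rw [← mul_right_cancel₀ hα this.1, ← mul_right_cancel₀ hβ this.2]
    · rintro rfl
      exact ⟨y, by rw [smul_add]⟩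
  rw [mk_eq_mk_iff', mk_eq_mk_iff', mk_eq_mk_iff', k1, k2, k3] at key
  have hin : (mk F _ hne) ∈ ptsIn l ∩ supp c ↔ c (mk F _ hne) ≠ 0 :=
    ⟨fun h => h.2, fun h => ⟨(ptIn_mk hne l).mpr hxl, h⟩⟩
  rw [hin] at key
  rw [liftVec_of_ne _ _ hne, map_eq_zero]
  refine not_iff_not.mp (key.trans ?_)
  rw [or_left_comm]
  simp only [ne_eq, not_and_or, not_not]

end Lifting

section Frames

variable {V : Type*} [AddCommGroup V] [Module F V] {f : V → F} {l W : Submodule F V} {e₁ e₂ d : V}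

theorem finrank_sup_span_singleton [FiniteDimensional F V] (hl : Module.finrank F l = 2)
    (hd : d ∉ l) : Module.finrank F (l ⊔ F ∙ d : Submodule F V) = 3 := by
  have hlt : l < l ⊔ F ∙ d := by
    refine lt_of_le_of_ne le_sup_left fun h => hd ?_
    rw [h]
    exact Submodule.mem_sup_right (Submodule.mem_span_singleton_self d)
  have h1 := Submodule.finrank_lt_finrank_of_lt hlt
  have h2 := Submodule.finrank_add_le_finrank_add_finrank l (F ∙ d)
  have h3 := finrank_span_singleton (K := F) (show d ≠ 0 from fun h => hd (h ▸ l.zero_mem))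
  omega

theorem exists_notMem_of_finrank_lt [FiniteDimensional F V] {K : Submodule F V}
    (h : Module.finrank F l < Module.finrank F K) : ∃ d ∈ K, d ∉ l := by
  by_contra! hK
  exact absurd (Submodule.finrank_mono hK) (by omega)

theorem exists_map_eq_zero_notMem [FiniteDimensional F V] (h4 : Module.finrank F V = 4)
    (hl : Module.finrank F l = 2) (Λ : V →ₗ[F] F) : ∃ d, d ∉ l ∧ Λ d = 0 := by
  have h1 := LinearMap.finrank_range_add_finrank_ker Λ
  have h2 := Submodule.finrank_le (LinearMap.range Λ)
  rw [Module.finrank_self] at h2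
  obtain ⟨d, hd, hdl⟩ := exists_notMem_of_finrank_lt (l := l) (K := LinearMap.ker Λ) (by omega)
  exact ⟨d, hdl, hd⟩

theorem exists_map_eq_zero₂ [FiniteDimensional F V] (hW : Module.finrank F W = 3)
    (φ ψ : V →ₗ[F] F) : ∃ v ∈ W, v ≠ 0 ∧ φ v = 0 ∧ ψ v = 0 := by
  have hker : LinearMap.ker ((φ.prod ψ).domRestrict W) ≠ ⊥ :=
    LinearMap.ker_ne_bot_of_finrank_lt (by simp [hW])
  obtain ⟨v, hv, hv0⟩ := Submodule.exists_mem_ne_zero_of_ne_bot hker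
  refine ⟨v, v.2, fun h => hv0 (Subtype.ext h), ?_⟩
  simpa using hv

/-- Two vectors outside `l` that stay outside `l` after adding and subtracting. -/
theorem exists_pair_notMem [FiniteDimensional F V] (h4 : Module.finrank F V = 4)
    (hl : Module.finrank F l = 2) :
    ∃ d d', d ∉ l ∧ d' ∉ l ∧ d + d' ∉ l ∧ d - d' ∉ l := by
  obtain ⟨d, hd, -⟩ := exists_map_eq_zero_notMem h4 hl 0
  have h3 := finrank_sup_span_singleton hl hd
  obtain ⟨d', -, hd'⟩ := exists_notMem_of_finrank_lt (l := l ⊔ F ∙ d) (K := ⊤) (by simp [h3, h4])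
  have hdm : d ∈ l ⊔ F ∙ d := Submodule.mem_sup_right (Submodule.mem_span_singleton_self d)
  refine ⟨d, d', hd, fun h => hd' (Submodule.mem_sup_left h), fun h => hd' ?_, fun h => hd' ?_⟩
  · simpa using sub_mem (Submodule.mem_sup_left h : _ ∈ l ⊔ F ∙ d) hdm
  · simpa using sub_mem hdm (Submodule.mem_sup_left h : _ ∈ l ⊔ F ∙ d)

namespace SecantFrame

theorem smul_add_mem (hF : SecantFrame f l e₁ e₂) (y z : F) : y • e₁ + z • e₂ ∈ l :=
  l.add_mem (l.smul_mem _ hF.mem₁) (l.smul_mem _ hF.mem₂)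

theorem smul_add_ne_zero (hF : SecantFrame f l e₁ e₂) {y z : F} (h : y ≠ 0 ∨ z ≠ 0) :
    y • e₁ + z • e₂ ≠ 0 := fun h0 =>
  h.elim (absurd (hF.indep y z h0).1) (absurd (hF.indep y z h0).2)

theorem smul_add_add_ne_zero (hF : SecantFrame f l e₁ e₂) (hd : d ∉ l) (y z : F) :
    y • e₁ + z • e₂ + d ≠ 0 := fun h =>
  hd (by rw [← neg_eq_of_add_eq_zero_right h]; exact l.neg_mem (hF.smul_add_mem y z))

theorem apply_left_ne_zero (hF : SecantFrame f l e₁ e₂) : f e₁ ≠ 0 := fun h => by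
  simpa [h] using hF.eq_zero_iff 1 0

theorem apply_right_ne_zero (hF : SecantFrame f l e₁ e₂) : f e₂ ≠ 0 := fun h => by
  simpa [h] using hF.eq_zero_iff 0 1

theorem apply_add_ne_zero (hF : SecantFrame f l e₁ e₂) : f (e₁ + e₂) ≠ 0 := fun h => by
  simpa [h] using hF.eq_zero_iff 1 1

theorem left_ne_zero (hF : SecantFrame f l e₁ e₂) : e₁ ≠ 0 := by
  simpa using hF.smul_add_ne_zero (y := 1) (z := 0) (by simp)

theorem right_ne_zero (hF : SecantFrame f l e₁ e₂) : e₂ ≠ 0 := by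
  simpa using hF.smul_add_ne_zero (y := 0) (z := 1) (by simp)

theorem add_ne_zero (hF : SecantFrame f l e₁ e₂) : e₁ + e₂ ≠ 0 := by
  simpa using hF.smul_add_ne_zero (y := 1) (z := 1) (by simp)

theorem exists_map_eq_zero (e₁ e₂ : V) (ψ : V →ₗ[F] F) :
    ∃ y z : F, (y ≠ 0 ∨ z ≠ 0) ∧ ψ (y • e₁ + z • e₂) = 0 := by
  by_cases h : ψ e₁ = 0
  · exact ⟨1, 0, by simp, by simp [h]⟩
  · exact ⟨-ψ e₂, ψ e₁, Or.inr h, by simp [mul_comm]⟩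

theorem le_ker (hF : SecantFrame f l e₁ e₂) [FiniteDimensional F V]
    (hl : Module.finrank F l = 2) {ψ : V →ₗ[F] F} (h₁ : ψ e₁ = 0) (h₂ : ψ e₂ = 0) :
    l ≤ LinearMap.ker ψ := by
  have hspan : Submodule.span F {e₁, e₂} = l := by
    refine Submodule.eq_of_le_of_finrank_le (Submodule.span_le.mpr ?_) ?_
    · rintro x (rfl | rfl)
      exacts [hF.mem₁, hF.mem₂]
    · have := finrank_span_eq_card (LinearIndependent.pair_iff.mpr hF.indep)
      rw [Matrix.range_cons_cons_empty, Fintype.card_fin] at this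
      rw [this, hl]
  rw [← hspan, Submodule.span_le]
  rintro x (rfl | rfl)
  exacts [h₁, h₂]

theorem vanish_of_two_zeros {ψ : V →ₗ[F] F} {t t' : F} (htt : t ≠ t')
    (h : ψ (e₁ + t • e₂) = 0) (h' : ψ (e₁ + t' • e₂) = 0) : ψ e₁ = 0 ∧ ψ e₂ = 0 := by
  simp only [map_add, map_smul, smul_eq_mul] at h h'
  have h2 : ψ e₂ = 0 := by
    have : (t - t') * ψ e₂ = 0 := by linear_combination h - h'
    exact (mul_eq_zero.mp this).resolve_left (sub_ne_zero.mpr htt)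
  exact ⟨by simpa [h2] using h, h2⟩

/-- If two functionals cover the zeros of `f` on a line of at least six points, then one of them
vanishes on the line. -/
theorem vanish_of_cover [Fintype F] (h5 : 5 ≤ Fintype.card F) (φ ψ : V →ₗ[F] F)
    (h : ∀ t : F, t ≠ 0 → t ≠ 1 → φ (e₁ + t • e₂) = 0 ∨ ψ (e₁ + t • e₂) = 0) :
    (φ e₁ = 0 ∧ φ e₂ = 0) ∨ (ψ e₁ = 0 ∧ ψ e₂ = 0) := by
  have hcard : 2 < ((Finset.univ : Finset F) \ {0, 1}).card := by
    have h1 := Finset.le_card_sdiff ({0, 1} : Finset F) Finset.univ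
    have h2 : ({0, 1} : Finset F).card ≤ 2 := Finset.card_le_two
    rw [Finset.card_univ] at h1
    omega
  obtain ⟨r, hr, s, hs, t, ht, hrs, hrt, hst⟩ := Finset.two_lt_card.mp hcard
  simp only [Finset.mem_sdiff, Finset.mem_univ, true_and, Finset.mem_insert,
    Finset.mem_singleton, not_or] at hr hs ht
  rcases h r hr.1 hr.2 with h1 | h1 <;> rcases h s hs.1 hs.2 with h2 | h2 <;>
    rcases h t ht.1 ht.2 with h3 | h3
  all_goals first
    | exact Or.inl (vanish_of_two_zeros hrs h1 h2)
    | exact Or.inl (vanish_of_two_zeros hrt h1 h3)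
    | exact Or.inl (vanish_of_two_zeros hst h2 h3)
    | exact Or.inr (vanish_of_two_zeros hrs h1 h2)
    | exact Or.inr (vanish_of_two_zeros hrt h1 h3)
    | exact Or.inr (vanish_of_two_zeros hst h2 h3)

theorem apply_add_smul (hF : SecantFrame f l e₁ e₂) {t : F} (h0 : t ≠ 0) (h1 : t ≠ 1) :
    f (e₁ + t • e₂) = 0 := by
  simpa [h0, Ne.symm h1] using (hF.eq_zero_iff 1 t (by simp)).mpr ⟨one_ne_zero, h0, Ne.symm h1⟩

end SecantFrame

theorem exists_moment_functional [Fintype F] {m n : ℕ} (hq : 3 ≤ Fintype.card F) (hm : 1 ≤ m)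
    (hn : 1 ≤ n) (hmn : m + n = Fintype.card F) {g : V → F}
    (hg : g ∈ Submodule.span F {g : V → F | ∃ φ : V →ₗ[F] F,
      g = fun v => 1 - φ v ^ (Fintype.card F - 1)}) (e₁ e₂ : V) :
    ∃ Λ : V →ₗ[F] F, ∀ d, ∑ y : F, ∑ z : F, y ^ m * z ^ n * g (y • e₁ + z • e₂ + d) = Λ d := by
  induction hg using Submodule.span_induction with
  | mem g hg =>
    obtain ⟨φ, rfl⟩ := hg
    obtain ⟨C, hC⟩ := exists_moment_line hq hm hn hmn (φ e₁) (φ e₂)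
    exact ⟨C • φ, fun d => by simpa using hC (φ d)⟩
  | zero => exact ⟨0, by simp⟩
  | add g k _ _ hg hk =>
    obtain ⟨Λ, hΛ⟩ := hg
    obtain ⟨M, hM⟩ := hk
    exact ⟨Λ + M, fun d => by
      simp only [Pi.add_apply, mul_add, Finset.sum_add_distrib, hΛ, hM, LinearMap.add_apply]⟩
  | smul a g _ hg =>
    obtain ⟨Λ, hΛ⟩ := hg
    exact ⟨a • Λ, fun d => by
      simp only [Pi.smul_apply, smul_eq_mul, mul_left_comm _ a, ← Finset.mul_sum, hΛ,
        LinearMap.smul_apply]⟩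

end Frames

section NormalForms

variable {V : Type*} [AddCommGroup V] [Module F V] {f : V → F} {l W : Submodule F V} {e₁ e₂ d : V}

namespace TriangleOn

variable {φ : Fin 3 → V →ₗ[F] F} {a : Fin 3 → F}

theorem sum_fin_three {i j k : Fin 3} (hij : i ≠ j) (hik : i ≠ k) (hjk : j ≠ k) (g : Fin 3 → F) :
    ∑ x, g x = g i + g j + g k := by
  have huniv : (Finset.univ : Finset (Fin 3)) = {i, j, k} := by
    revert i j k; decide
  rw [huniv, Finset.sum_insert (by simp [hij, hik]), Finset.sum_pair hjk, add_assoc]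

theorem forall_fin_three {i j k : Fin 3} (hij : i ≠ j) (hik : i ≠ k) (hjk : j ≠ k)
    {P : Fin 3 → Prop} (hi : P i) (hj : P j) (hk : P k) (x : Fin 3) : P x := by
  have : x = i ∨ x = j ∨ x = k := by clear hi hj hk; revert i j k x; decide
  rcases this with rfl | rfl | rfl
  exacts [hi, hj, hk]

theorem exists_ne_ne (i : Fin 3) : ∃ j k : Fin 3, i ≠ j ∧ i ≠ k ∧ j ≠ k := by
  revert i; decide

theorem exists_map_eq_zero (hT : TriangleOn f W φ a) {v : V} (hv : v ∈ W) (hv0 : v ≠ 0)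
    (hf : f v ≠ 0) : ∃ i, φ i v = 0 := by
  by_contra! h
  exact hf (by rw [hT.eq v hv hv0]; simp [h])

/-- The coordinates in which a triangle through the three points of a secant reads off. -/
theorem exists_normal_form (hT : TriangleOn f W φ a) (hF : SecantFrame f l e₁ e₂) (hlW : l ≤ W)
    (hdW : d ∈ W) (hd : d ∉ l) (hside : ∀ i, ¬ (φ i e₁ = 0 ∧ φ i e₂ = 0)) :
    ∃ s₁ s₂ s₃ : F, s₂ - s₁ - s₃ ≠ 0 ∧ f e₁ + f e₂ + f (e₁ + e₂) = ∑ i, a i ∧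
      ∀ y z : F, f (y • e₁ + z • e₂ + d) = (if z = s₁ then f e₁ else 0) +
        (if y = s₂ then f e₂ else 0) + (if y - z = s₃ then f (e₁ + e₂) else 0) := by
  have h12 := l.add_mem hF.mem₁ hF.mem₂
  obtain ⟨i, hi⟩ := hT.exists_map_eq_zero (hlW hF.mem₁) hF.left_ne_zero hF.apply_left_ne_zero
  obtain ⟨j, hj⟩ := hT.exists_map_eq_zero (hlW hF.mem₂) hF.right_ne_zero hF.apply_right_ne_zero
  obtain ⟨k, hk⟩ := hT.exists_map_eq_zero (hlW h12) hF.add_ne_zero hF.apply_add_ne_zero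
  have hi2 : φ i e₂ ≠ 0 := fun h => hside i ⟨hi, h⟩
  have hj1 : φ j e₁ ≠ 0 := fun h => hside j ⟨h, hj⟩
  have hk' : φ k e₂ = -φ k e₁ := by
    rw [map_add] at hk
    linear_combination hk
  have hk1 : φ k e₁ ≠ 0 := fun h => hside k ⟨h, by rw [hk', h, neg_zero]⟩
  have hij : i ≠ j := by rintro rfl; exact hj1 hi
  have hik : i ≠ k := by rintro rfl; exact hk1 hi
  have hjk : j ≠ k := by rintro rfl; exact hk1 (by rw [← neg_eq_zero, ← hk', hj])
  have b₁ : f e₁ = a i := by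
    rw [hT.eq _ (hlW hF.mem₁) hF.left_ne_zero, sum_fin_three hij hik hjk]
    simp [hi, hj1, hk1]
  have b₂ : f e₂ = a j := by
    rw [hT.eq _ (hlW hF.mem₂) hF.right_ne_zero, sum_fin_three hij hik hjk]
    simp [hi2, hj, hk', hk1]
  have b₃ : f (e₁ + e₂) = a k := by
    rw [hT.eq _ (hlW h12) hF.add_ne_zero, sum_fin_three hij hik hjk]
    simp [hi, hi2, hj, hj1, hk']
  have ei : ∀ y z : F, φ i (y • e₁ + z • e₂ + d) = 0 ↔ z = -φ i d / φ i e₂ := by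
    intro y z
    rw [eq_div_iff hi2, eq_neg_iff_add_eq_zero]
    simp [hi]
  have ej : ∀ y z : F, φ j (y • e₁ + z • e₂ + d) = 0 ↔ y = -φ j d / φ j e₁ := by
    intro y z
    rw [eq_div_iff hj1, eq_neg_iff_add_eq_zero]
    simp [hj]
  have ek : ∀ y z : F, φ k (y • e₁ + z • e₂ + d) = 0 ↔ y - z = -φ k d / φ k e₁ := by
    intro y z
    rw [eq_div_iff hk1, eq_neg_iff_add_eq_zero]
    simp only [map_add, map_smul, smul_eq_mul, hk']
    ring_nf
  have hvW : ∀ y z : F, y • e₁ + z • e₂ + d ∈ W := fun y z =>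
    W.add_mem (hlW (hF.smul_add_mem y z)) hdW
  have hv0 := hF.smul_add_add_ne_zero hd
  refine ⟨-φ i d / φ i e₂, -φ j d / φ j e₁, -φ k d / φ k e₁, fun h => ?_, ?_, fun y z => ?_⟩
  · refine hv0 (-φ j d / φ j e₁) (-φ i d / φ i e₂) (hT.joint _ (hvW _ _) ?_)
    exact forall_fin_three hij hik hjk ((ei _ _).mpr rfl) ((ej _ _).mpr rfl)
      ((ek _ _).mpr (sub_eq_zero.mp h))
  · rw [b₁, b₂, b₃, sum_fin_three hij hik hjk]
  · rw [hT.eq _ (hvW y z) (hv0 y z), sum_fin_three hij hik hjk, b₁, b₂, b₃]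
    simp only [ei, ej, ek]

theorem side_of_five_le [Fintype F] (h5 : 5 ≤ Fintype.card F) (hT : TriangleOn f W φ a)
    (hF : SecantFrame f l e₁ e₂) (hlW : l ≤ W) (i : Fin 3) : ¬ (φ i e₁ = 0 ∧ φ i e₂ = 0) := by
  rintro ⟨h1, h2⟩
  obtain ⟨j, k, hij, hik, hjk⟩ := exists_ne_ne i
  have hi : ∀ y z : F, φ i (y • e₁ + z • e₂) = 0 := by simp [h1, h2]
  have key : ∀ j k, i ≠ j → i ≠ k → j ≠ k → ¬ (φ j e₁ = 0 ∧ φ j e₂ = 0) := by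
    rintro j k hij hik hjk ⟨h1, h2⟩
    obtain ⟨y, z, hyz, hk⟩ := SecantFrame.exists_map_eq_zero e₁ e₂ (φ k)
    exact hF.smul_add_ne_zero hyz (hT.joint _ (hlW (hF.smul_add_mem y z))
      (forall_fin_three hij hik hjk (hi y z) (by simp [h1, h2]) hk))
  refine (SecantFrame.vanish_of_cover h5 (φ j) (φ k) fun t h0 h1 => ?_).elim
    (key j k hij hik hjk) (key k j hik hij hjk.symm)
  by_contra! h
  have hv0 : e₁ + t • e₂ ≠ 0 := by simpa using hF.smul_add_ne_zero (y := 1) (z := t) (by simp)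
  have hvl : e₁ + t • e₂ ∈ l := by simpa using hF.smul_add_mem 1 t
  have := hF.apply_add_smul h0 h1
  rw [hT.eq _ (hlW hvl) hv0, sum_fin_three hij hik hjk, if_neg h.1, if_neg h.2,
    if_pos (by simpa using hi 1 t)] at this
  exact hT.ne_zero i (by simpa using this)

theorem side_of_card_eq_three (h2 : (2 : F) ≠ 0) (hT : TriangleOn f W φ a)
    (hF : SecantFrame f l e₁ e₂) (hlW : l ≤ W) {b : F} (ha : ∀ i, a i = b) (i : Fin 3) :
    ¬ (φ i e₁ = 0 ∧ φ i e₂ = 0) := by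
  rintro ⟨hi1, hi2⟩
  obtain ⟨j, k, hij, hik, hjk⟩ := exists_ne_ne i
  have hm1 : (-1 : F) ≠ 1 := fun h => h2 (by linear_combination -h)
  have hi : φ i (e₁ + (-1 : F) • e₂) = 0 := by simp [hi1, hi2]
  have hv0 : e₁ + (-1 : F) • e₂ ≠ 0 := by
    simpa using hF.smul_add_ne_zero (y := 1) (z := -1) (by simp)
  have hvl : e₁ + (-1 : F) • e₂ ∈ l := by simpa using hF.smul_add_mem 1 (-1)
  have hb : b ≠ 0 := ha i ▸ hT.ne_zero i
  have := hF.apply_add_smul (neg_ne_zero.mpr one_ne_zero) hm1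
  rw [hT.eq _ (hlW hvl) hv0, sum_fin_three hij hik hjk, if_pos hi, ha, ha, ha] at this
  by_cases hj : φ j (e₁ + (-1 : F) • e₂) = 0 <;> by_cases hk : φ k (e₁ + (-1 : F) • e₂) = 0
  · exact hv0 (hT.joint _ (hlW hvl) (forall_fin_three hij hik hjk hi hj hk))
  · rw [if_pos hj, if_neg hk] at this
    exact mul_ne_zero h2 hb (by linear_combination this)
  · rw [if_neg hj, if_pos hk] at this
    exact mul_ne_zero h2 hb (by linear_combination this)
  · rw [if_neg hj, if_neg hk] at this
    exact hb (by linear_combination this)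

end TriangleOn

namespace OddOn

variable {U₁ U₂ U₃ Z : V →ₗ[F] F} {a₁ a₂ a₃ : F}

theorem rotate (hO : OddOn f W U₁ U₂ U₃ Z a₁ a₂ a₃) : OddOn f W U₂ U₃ U₁ Z a₂ a₃ a₁ where
  sum_zero v := by linear_combination hO.sum_zero v
  joint v hv h2 h3 hZ := hO.joint v hv (by linear_combination hO.sum_zero v - h2 - h3) h2 hZ
  eq v hv hv0 := by rw [hO.eq v hv hv0]; ring

theorem swap (hO : OddOn f W U₁ U₂ U₃ Z a₁ a₂ a₃) : OddOn f W U₂ U₁ U₃ (-Z) a₂ a₁ a₃ where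
  sum_zero v := by linear_combination hO.sum_zero v
  joint v hv h2 h1 hZ := hO.joint v hv h1 h2 (by simpa using hZ)
  eq v hv hv0 := by
    have h := hO.sum_zero v
    rw [hO.eq v hv hv0]
    have e1 : (if U₁ v = 0 then Z v / U₂ v + a₁ else 0) =
        if U₁ v = 0 then (-Z) v / U₃ v + a₁ else 0 := by
      split_ifs with h1
      · rw [show U₃ v = -U₂ v by linear_combination h - h1, LinearMap.neg_apply, neg_div_neg_eq]
      · rfl
    have e2 : (if U₂ v = 0 then Z v / U₃ v + a₂ else 0) =
        if U₂ v = 0 then (-Z) v / U₁ v + a₂ else 0 := by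
      split_ifs with h1
      · rw [show U₃ v = -U₁ v by linear_combination h - h1, LinearMap.neg_apply, neg_div, div_neg]
      · rfl
    have e3 : (if U₃ v = 0 then Z v / U₁ v + a₃ else 0) =
        if U₃ v = 0 then (-Z) v / U₂ v + a₃ else 0 := by
      split_ifs with h1
      · rw [show U₁ v = -U₂ v by linear_combination h - h1, LinearMap.neg_apply, neg_div, div_neg]
      · rfl
    rw [e1, e2, e3]
    ring

theorem exists_map_eq_zero (hO : OddOn f W U₁ U₂ U₃ Z a₁ a₂ a₃) {v : V} (hv : v ∈ W)
    (hv0 : v ≠ 0) (hf : f v ≠ 0) : U₁ v = 0 ∨ U₂ v = 0 ∨ U₃ v = 0 := by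
  by_contra! h
  exact hf (by rw [hO.eq v hv hv0]; simp [h])

theorem exists_normal_form_aux (hO : OddOn f W U₁ U₂ U₃ Z a₁ a₂ a₃)
    (hF : SecantFrame f l e₁ e₂) (hlW : l ≤ W) (hdW : d ∈ W) (hd : d ∉ l)
    (h₁ : U₁ e₁ = 0) (h₂ : U₂ e₂ = 0) (h₁' : U₁ e₂ ≠ 0) (h₂' : U₂ e₁ ≠ 0) :
    ∃ s₁ s₂ γ : F, γ ≠ 0 ∧ f e₁ + f e₂ + f (e₁ + e₂) = a₁ + a₂ + a₃ ∧
      ∀ y z : F, f (y • e₁ + z • e₂ + d) =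
        oddPattern (f e₁) (f e₂) (f (e₁ + e₂)) s₁ s₂ γ y z := by
  have h12 := l.add_mem hF.mem₁ hF.mem₂
  have h3 : U₃ (e₁ + e₂) = 0 := by
    rcases hO.exists_map_eq_zero (hlW h12) hF.add_ne_zero hF.apply_add_ne_zero with h | h | h
    · exact absurd (by simpa [h₁] using h) h₁'
    · exact absurd (by simpa [h₂] using h) h₂'
    · exact h
  obtain ⟨α, hα⟩ : ∃ α, α = U₁ e₂ := ⟨_, rfl⟩
  have hα0 : α ≠ 0 := hα ▸ h₁'
  have s1 := hO.sum_zero e₁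
  have s2 := hO.sum_zero e₂
  rw [map_add] at h3
  have u21 : U₂ e₁ = -α := by linear_combination s1 + s2 - h3 - h₁ - h₂ + hα
  have u31 : U₃ e₁ = α := by linear_combination s1 - h₁ - u21
  have u32 : U₃ e₂ = -α := by linear_combination s2 - h₂ + hα
  have b₁ : f e₁ = a₁ - Z e₁ / α := by
    rw [hO.eq _ (hlW hF.mem₁) hF.left_ne_zero, h₁, u21, u31]
    simp only [if_true, neg_eq_zero, hα0, if_false, div_neg]
    ring
  have b₂ : f e₂ = a₂ - Z e₂ / α := by
    rw [hO.eq _ (hlW hF.mem₂) hF.right_ne_zero, ← hα, h₂, u32]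
    simp only [if_true, neg_eq_zero, hα0, if_false, div_neg]
    ring
  have b₃ : f (e₁ + e₂) = a₃ + (Z e₁ + Z e₂) / α := by
    rw [hO.eq _ (hlW h12) hF.add_ne_zero]
    simp only [map_add, h₁, h₂, u21, u31, u32, ← hα, zero_add, add_zero, neg_eq_zero, hα0,
      if_false, add_neg_cancel, if_true]
    ring
  obtain ⟨s₁, hs₁⟩ : ∃ s₁, α * s₁ = -U₁ d := ⟨-U₁ d / α, by field_simp⟩
  obtain ⟨s₂, hs₂⟩ : ∃ s₂, α * s₂ = U₂ d := ⟨U₂ d / α, by field_simp⟩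
  have hvW : ∀ y z : F, y • e₁ + z • e₂ + d ∈ W := fun y z =>
    W.add_mem (hlW (hF.smul_add_mem y z)) hdW
  have hv0 := hF.smul_add_add_ne_zero hd
  have e1 : ∀ y z : F, U₁ (y • e₁ + z • e₂ + d) = α * (z - s₁) := by
    intro y z
    simp only [map_add, map_smul, smul_eq_mul, h₁, ← hα]
    linear_combination hs₁
  have e2 : ∀ y z : F, U₂ (y • e₁ + z • e₂ + d) = -(α * (y - s₂)) := by
    intro y z
    simp only [map_add, map_smul, smul_eq_mul, h₂, u21]
    linear_combination -hs₂
  have e3 : ∀ y z : F, U₃ (y • e₁ + z • e₂ + d) = α * ((y - s₂) - (z - s₁)) := by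
    intro y z
    linear_combination hO.sum_zero (y • e₁ + z • e₂ + d) - e1 y z - e2 y z
  obtain ⟨ζ, hζ⟩ : ∃ ζ, ζ = Z (s₂ • e₁ + s₁ • e₂ + d) := ⟨_, rfl⟩
  have eZ : ∀ y z : F, Z (y • e₁ + z • e₂ + d) = (y - s₂) * Z e₁ + (z - s₁) * Z e₂ + ζ := by
    intro y z
    rw [hζ]
    simp only [map_add, map_smul, smul_eq_mul]
    ring
  have hζ0 : ζ ≠ 0 := fun h => hv0 s₂ s₁ (hO.joint _ (hvW _ _) (by rw [e1]; ring)
    (by rw [e2]; ring) (by rw [← hζ, h]))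
  refine ⟨s₁, s₂, -ζ / α, div_ne_zero (neg_ne_zero.mpr hζ0) hα0, ?_, fun y z => ?_⟩
  · rw [b₁, b₂, b₃]; ring
  · rw [hO.eq _ (hvW y z) (hv0 y z), e1, e2, e3, eZ, b₁, b₂, b₃, oddPattern]
    simp only [neg_eq_zero, mul_eq_zero, hα0, false_or, sub_eq_zero (a := y) (b := s₂),
      sub_eq_zero (a := z) (b := s₁), sub_eq_zero (a := y - s₂)]
    by_cases hy : y = s₂
    · by_cases hz : z = s₁
      · simp [hy, hz]; ring
      · have hz' : z - s₁ ≠ 0 := sub_ne_zero.mpr hz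
        simp only [hy, hz, sub_self, if_true, if_false, hz'.symm]
        field_simp
        ring
    · have hy' : y - s₂ ≠ 0 := sub_ne_zero.mpr hy
      by_cases hz : z = s₁
      · simp only [hy, hz, sub_self, if_true, if_false, hy']
        field_simp
        ring
      · by_cases h : y - s₂ = z - s₁
        · rw [← h]
          simp only [hy, hz, if_true, if_false]
          field_simp
          ring
        · simp only [hy, hz, h, if_false]

/-- The coordinates in which a `T^odd` word through the three points of a secant reads off. -/
theorem exists_normal_form (hO : OddOn f W U₁ U₂ U₃ Z a₁ a₂ a₃)
    (hF : SecantFrame f l e₁ e₂) (hlW : l ≤ W) (hdW : d ∈ W) (hd : d ∉ l)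
    (h₁ : ¬ (U₁ e₁ = 0 ∧ U₁ e₂ = 0)) (h₂ : ¬ (U₂ e₁ = 0 ∧ U₂ e₂ = 0))
    (h₃ : ¬ (U₃ e₁ = 0 ∧ U₃ e₂ = 0)) :
    ∃ s₁ s₂ γ : F, γ ≠ 0 ∧ f e₁ + f e₂ + f (e₁ + e₂) = a₁ + a₂ + a₃ ∧
      ∀ y z : F, f (y • e₁ + z • e₂ + d) =
        oddPattern (f e₁) (f e₂) (f (e₁ + e₂)) s₁ s₂ γ y z := by
  have key : ∀ {U₁ U₂ U₃ Z : V →ₗ[F] F} {a₁ a₂ a₃ : F}, OddOn f W U₁ U₂ U₃ Z a₁ a₂ a₃ →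
      ¬ (U₁ e₁ = 0 ∧ U₁ e₂ = 0) → ¬ (U₂ e₁ = 0 ∧ U₂ e₂ = 0) → ¬ (U₃ e₁ = 0 ∧ U₃ e₂ = 0) →
      U₁ e₁ = 0 → ∃ s₁ s₂ γ : F, γ ≠ 0 ∧ f e₁ + f e₂ + f (e₁ + e₂) = a₁ + a₂ + a₃ ∧
        ∀ y z : F, f (y • e₁ + z • e₂ + d) =
          oddPattern (f e₁) (f e₂) (f (e₁ + e₂)) s₁ s₂ γ y z := by
    intro U₁ U₂ U₃ Z a₁ a₂ a₃ hO h₁ h₂ h₃ h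
    rcases hO.exists_map_eq_zero (hlW hF.mem₂) hF.right_ne_zero hF.apply_right_ne_zero
      with h' | h' | h'
    · exact absurd ⟨h, h'⟩ h₁
    · exact hO.exists_normal_form_aux hF hlW hdW hd h h' (fun h0 => h₁ ⟨h, h0⟩)
        (fun h0 => h₂ ⟨h0, h'⟩)
    · obtain ⟨s₁, s₂, γ, hγ, hs, hp⟩ := hO.swap.rotate.exists_normal_form_aux hF hlW hdW hd h h'
        (fun h0 => h₁ ⟨h, h0⟩) (fun h0 => h₃ ⟨h0, h'⟩)
      exact ⟨s₁, s₂, γ, hγ, hs.trans (by ring), hp⟩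
  rcases hO.exists_map_eq_zero (hlW hF.mem₁) hF.left_ne_zero hF.apply_left_ne_zero with h | h | h
  · exact key hO h₁ h₂ h₃ h
  · obtain ⟨s₁, s₂, γ, hγ, hs, hp⟩ := key hO.rotate h₂ h₃ h₁ h
    exact ⟨s₁, s₂, γ, hγ, hs.trans (by ring), hp⟩
  · obtain ⟨s₁, s₂, γ, hγ, hs, hp⟩ := key hO.rotate.rotate h₃ h₁ h₂ h
    exact ⟨s₁, s₂, γ, hγ, hs.trans (by ring), hp⟩

theorem side_of_five_le [Fintype F] (h5 : 5 ≤ Fintype.card F)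
    (hO : OddOn f W U₁ U₂ U₃ Z a₁ a₂ a₃) (hF : SecantFrame f l e₁ e₂) (hlW : l ≤ W) :
    ¬ (U₁ e₁ = 0 ∧ U₁ e₂ = 0) := by
  rintro ⟨h1, h2⟩
  have h0 : ∀ y z : F, U₁ (y • e₁ + z • e₂) = 0 := by simp [h1, h2]
  have key : ∀ y z : F, (y ≠ 0 ∨ z ≠ 0) → U₂ (y • e₁ + z • e₂) = 0 →
      Z (y • e₁ + z • e₂) = 0 → False := fun y z hyz h hZ =>
    hF.smul_add_ne_zero hyz (hO.joint _ (hlW (hF.smul_add_mem y z)) (h0 y z) h hZ)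
  rcases SecantFrame.vanish_of_cover h5 U₂ (Z + a₁ • U₂) (e₁ := e₁) (e₂ := e₂) (fun t ht0 ht1 => by
    by_contra! h
    have hv0 : e₁ + t • e₂ ≠ 0 := by simpa using hF.smul_add_ne_zero (y := 1) (z := t) (by simp)
    have hvl : e₁ + t • e₂ ∈ l := by simpa using hF.smul_add_mem 1 t
    have hU₁ : U₁ (e₁ + t • e₂) = 0 := by simpa using h0 1 t
    have hU₃ : U₃ (e₁ + t • e₂) ≠ 0 := fun h3 =>
      h.1 (by linear_combination hO.sum_zero (e₁ + t • e₂) - hU₁ - h3)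
    have := hF.apply_add_smul ht0 ht1
    rw [hO.eq _ (hlW hvl) hv0, if_pos hU₁, if_neg h.1, if_neg hU₃, add_zero, add_zero,
      div_add' _ _ _ h.1, div_eq_zero_iff] at this
    exact h.2 (this.resolve_right h.1)) with ⟨k1, k2⟩ | ⟨k1, k2⟩
  · obtain ⟨y, z, hyz, hZ⟩ := SecantFrame.exists_map_eq_zero e₁ e₂ Z
    exact key y z hyz (by simp [k1, k2]) hZ
  · obtain ⟨y, z, hyz, hU⟩ := SecantFrame.exists_map_eq_zero e₁ e₂ U₂
    refine key y z hyz hU ?_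
    have : (Z + a₁ • U₂) (y • e₁ + z • e₂) = 0 := by simp only [map_add, map_smul, k1, k2]; simp
    simpa only [LinearMap.add_apply, LinearMap.smul_apply, hU, smul_zero, add_zero] using this

theorem side_of_card_eq_three [Fintype F] (h3 : Fintype.card F = 3)
    (hO : OddOn f W U₁ U₂ U₃ Z a₁ a₂ a₃) (hF : SecantFrame f l e₁ e₂) (hlW : l ≤ W)
    (ha : a₁ + a₂ + a₃ = 0) : ¬ (U₁ e₁ = 0 ∧ U₁ e₂ = 0) := by
  rintro ⟨h1, h2⟩
  have h0 : ∀ y z : F, U₁ (y • e₁ + z • e₂) = 0 := by simp [h1, h2]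
  have key : ∀ y z : F, (y ≠ 0 ∨ z ≠ 0) → U₂ (y • e₁ + z • e₂) = 0 →
      Z (y • e₁ + z • e₂) = 0 → False := fun y z hyz h hZ =>
    hF.smul_add_ne_zero hyz (hO.joint _ (hlW (hF.smul_add_mem y z)) (h0 y z) h hZ)
  have hz : ∀ y z : F, (y ≠ 0 ∨ z ≠ 0) → f (y • e₁ + z • e₂) = 0 → y ≠ 0 ∧ z = -y := by
    intro y z hyz hf
    obtain ⟨hy, hz, hyz'⟩ := (hF.eq_zero_iff y z hyz).mp hf
    refine ⟨hy, ?_⟩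
    have hy2 := FiniteField.pow_card_sub_one_eq_one y hy
    have hz2 := FiniteField.pow_card_sub_one_eq_one z hz
    rw [h3] at hy2 hz2
    have : (z - y) * (z + y) = 0 := by linear_combination hz2 - hy2
    exact eq_neg_of_add_eq_zero_left
      ((mul_eq_zero.mp this).resolve_left (sub_ne_zero.mpr hyz'.symm))
  obtain ⟨y, z, hyz, hU⟩ := SecantFrame.exists_map_eq_zero e₁ e₂ U₂
  have hU3 : U₃ (y • e₁ + z • e₂) = 0 := by
    linear_combination hO.sum_zero (y • e₁ + z • e₂) - h0 y z - hU
  have hf : f (y • e₁ + z • e₂) = 0 := by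
    rw [hO.eq _ (hlW (hF.smul_add_mem y z)) (hF.smul_add_ne_zero hyz), h0, hU, hU3]
    simpa using ha
  obtain ⟨hy, rfl⟩ := hz y z hyz hf
  obtain ⟨y', z', hyz', hZ⟩ := SecantFrame.exists_map_eq_zero e₁ e₂ (Z + a₁ • U₂)
  simp only [LinearMap.add_apply, LinearMap.smul_apply, smul_eq_mul] at hZ
  by_cases hU' : U₂ (y' • e₁ + z' • e₂) = 0
  · exact key y' z' hyz' hU' (by simpa only [hU', mul_zero, add_zero] using hZ)
  · have hU3' : U₃ (y' • e₁ + z' • e₂) ≠ 0 := fun h =>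
      hU' (by linear_combination hO.sum_zero (y' • e₁ + z' • e₂) - h0 y' z' - h)
    have hf' : f (y' • e₁ + z' • e₂) = 0 := by
      rw [hO.eq _ (hlW (hF.smul_add_mem y' z')) (hF.smul_add_ne_zero hyz'), if_pos (h0 _ _),
        if_neg hU', if_neg hU3', add_zero, add_zero, div_add' _ _ _ hU', hZ, zero_div]
    obtain ⟨-, rfl⟩ := hz y' z' hyz' hf'
    simp only [map_add, map_smul, smul_eq_mul] at hU hU'
    have hU'' : y * (U₂ e₁ - U₂ e₂) = 0 := by linear_combination hU
    have := (mul_eq_zero.mp hU'').resolve_left hy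
    exact hU' (by linear_combination y' * this)

end OddOn

end NormalForms

section Pencils

variable {V : Type*} [AddCommGroup V] [Module F V] {f g : V → F} {l : Submodule F V} {e₁ e₂ : V}

theorem mem_sup_span_singleton (l : Submodule F V) (d : V) : d ∈ l ⊔ F ∙ d :=
  Submodule.mem_sup_right (Submodule.mem_span_singleton_self d)

theorem SecantFrame.exists_moment [Fintype F] {m n : ℕ} (hq : 3 ≤ Fintype.card F) (hm : 1 ≤ m)
    (hn : 1 ≤ n) (hmn : m + n = Fintype.card F)
    (hg : g ∈ Submodule.span F {g : V → F | ∃ φ : V →ₗ[F] F,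
      g = fun v => 1 - φ v ^ (Fintype.card F - 1)}) (hfg : ∀ v, v ≠ 0 → f v = g v)
    (hF : SecantFrame f l e₁ e₂) : ∃ Λ : V →ₗ[F] F, ∀ d, d ∉ l →
      ∑ y : F, ∑ z : F, y ^ m * z ^ n * f (y • e₁ + z • e₂ + d) = Λ d := by
  obtain ⟨Λ, hΛ⟩ := exists_moment_functional hq hm hn hmn hg e₁ e₂
  exact ⟨Λ, fun d hd => by simp only [← hΛ d, hfg _ (hF.smul_add_add_ne_zero hd _ _)]⟩

theorem no_triangle_pencil_of_five_le [Fintype F] [FiniteDimensional F V]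
    (h5 : 5 ≤ Fintype.card F) (h4 : Module.finrank F V = 4) (hl : Module.finrank F l = 2)
    (hg : g ∈ Submodule.span F {g : V → F | ∃ φ : V →ₗ[F] F,
      g = fun v => 1 - φ v ^ (Fintype.card F - 1)}) (hfg : ∀ v, v ≠ 0 → f v = g v)
    (hF : SecantFrame f l e₁ e₂) (hT : ∀ d, d ∉ l → ∃ φ a, TriangleOn f (l ⊔ F ∙ d) φ a) :
    False := by
  obtain ⟨m, hm, hm0⟩ : ∃ m : ℕ, (m = 2 ∨ m = 3) ∧ (m : F) ≠ 0 := by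
    by_contra! h
    have h2 : (2 : F) = 0 := by exact_mod_cast h 2 (Or.inl rfl)
    have h3 : (3 : F) = 0 := by exact_mod_cast h 3 (Or.inr rfl)
    exact one_ne_zero (α := F) (by linear_combination h3 - h2)
  obtain ⟨Λ₁, hΛ₁⟩ := hF.exists_moment (m := Fintype.card F - 1) (n := 1) (by omega) (by omega)
    le_rfl (by omega) hg hfg
  obtain ⟨Λ₂, hΛ₂⟩ := hF.exists_moment (m := 1) (n := Fintype.card F - 1) (by omega) le_rfl
    (by omega) (by omega) hg hfg
  obtain ⟨Λ₃, hΛ₃⟩ := hF.exists_moment (m := m) (n := Fintype.card F - m) (by omega) (by omega)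
    (by omega) (by omega) hg hfg
  have hb₁ := hF.apply_left_ne_zero
  have hb₂ := hF.apply_right_ne_zero
  have hb₃ := hF.apply_add_ne_zero
  obtain ⟨d, hd, hd0⟩ := exists_map_eq_zero_notMem h4 hl
    ((f e₁)⁻¹ • Λ₁ - (f e₂)⁻¹ • Λ₂ +
      ((f (e₁ + e₂) / f e₂ + f (e₁ + e₂) / f e₁ + 1) / (f (e₁ + e₂) * m)) • Λ₃)
  obtain ⟨φ, a, hφ⟩ := hT d hd
  obtain ⟨s₁, s₂, s₃, hs, -, hp⟩ := hφ.exists_normal_form hF le_sup_left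
    (mem_sup_span_singleton l d) hd (hφ.side_of_five_le h5 hF le_sup_left)
  have hcast : ((Fintype.card F - 1 : ℕ) : F) = -1 := by
    rw [Nat.cast_sub (by omega), FiniteField.cast_card_eq_zero]
    simp
  have m₁ := hΛ₁ d hd
  have m₂ := hΛ₂ d hd
  have m₃ := hΛ₃ d hd
  simp_rw [hp] at m₁ m₂ m₃
  rw [triangle_moment (by omega) (by omega) (by omega), sum_pow_card_sub_one_eq, hcast] at m₁
  rw [triangle_moment (by omega) (by omega) (by omega), sum_pow_card_sub_one_eq] at m₂
  rw [triangle_moment (by omega) (by omega) (by omega),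
    FiniteField.sum_pow_lt_card_sub_one F m (by omega),
    FiniteField.sum_pow_lt_card_sub_one F (Fintype.card F - m) (by omega)] at m₃
  simp only [pow_one, sum_id_eq_zero (F := F) (by omega)] at m₁ m₂
  apply hs
  simp only [LinearMap.add_apply, LinearMap.sub_apply, LinearMap.smul_apply, smul_eq_mul,
    ← m₁, ← m₂, ← m₃] at hd0
  field_simp at hd0
  have h0 : f e₁ * f e₂ * f (e₁ + e₂) * m * (s₂ - s₁ - s₃) = 0 := by
    push_cast at hd0
    linear_combination hd0
  exact (mul_eq_zero.mp h0).resolve_left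
    (mul_ne_zero (mul_ne_zero (mul_ne_zero hb₁ hb₂) hb₃) hm0)

theorem no_odd_pencil_of_five_le [Fintype F] [FiniteDimensional F V]
    (h5 : 5 ≤ Fintype.card F) (h2 : (2 : F) ≠ 0) (h4 : Module.finrank F V = 4)
    (hl : Module.finrank F l = 2)
    (hg : g ∈ Submodule.span F {g : V → F | ∃ φ : V →ₗ[F] F,
      g = fun v => 1 - φ v ^ (Fintype.card F - 1)}) (hfg : ∀ v, v ≠ 0 → f v = g v)
    (hF : SecantFrame f l e₁ e₂)
    (hO : ∀ d, d ∉ l → ∃ U₁ U₂ U₃ Z a₁ a₂ a₃, OddOn f (l ⊔ F ∙ d) U₁ U₂ U₃ Z a₁ a₂ a₃) :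
    False := by
  obtain ⟨Λ₁, hΛ₁⟩ := hF.exists_moment (m := 2) (n := Fintype.card F - 2) (by omega) (by omega)
    (by omega) (by omega) hg hfg
  obtain ⟨Λ₂, hΛ₂⟩ := hF.exists_moment (m := Fintype.card F - 2) (n := 2) (by omega) (by omega)
    (by omega) (by omega) hg hfg
  obtain ⟨d, hd, hd0⟩ := exists_map_eq_zero_notMem h4 hl (Λ₁ + Λ₂)
  obtain ⟨U₁, U₂, U₃, Z, a₁, a₂, a₃, hU⟩ := hO d hd
  obtain ⟨s₁, s₂, γ, hγ, -, hp⟩ := hU.exists_normal_form hF le_sup_left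
    (mem_sup_span_singleton l d) hd (hU.side_of_five_le h5 hF le_sup_left)
    (hU.rotate.side_of_five_le h5 hF le_sup_left)
    (hU.rotate.rotate.side_of_five_le h5 hF le_sup_left)
  have m₁ := hΛ₁ d hd
  have m₂ := hΛ₂ d hd
  simp_rw [hp] at m₁ m₂
  rw [odd_moment h5] at m₁
  rw [Finset.sum_comm] at m₂
  simp_rw [oddPattern_swap (f e₁), mul_comm (_ ^ (Fintype.card F - 2)) (_ ^ 2)] at m₂
  rw [odd_moment h5] at m₂
  rw [LinearMap.add_apply, ← m₁, ← m₂] at hd0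
  exact mul_ne_zero h2 hγ (by linear_combination hd0)

/-- Over the field of two elements a code word is an affine function, hence constant on some
plane through a `3`-secant. -/
theorem SecantFrame.exists_constant [Fintype F] [FiniteDimensional F V]
    (hq : Fintype.card F = 2) (h4 : Module.finrank F V = 4) (hl : Module.finrank F l = 2)
    (hg : g ∈ Submodule.span F {g : V → F | ∃ φ : V →ₗ[F] F,
      g = fun v => 1 - φ v ^ (Fintype.card F - 1)}) (hfg : ∀ v, v ≠ 0 → f v = g v)
    (hF : SecantFrame f l e₁ e₂) :
    ∃ d, d ∉ l ∧ ∀ v ∈ l ⊔ F ∙ d, v ≠ 0 → f v = 1 := by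
  obtain ⟨κ, ψ, hψ⟩ : ∃ (κ : F) (ψ : V →ₗ[F] F), ∀ v, g v = κ + ψ v := by
    clear hfg
    induction hg using Submodule.span_induction with
    | mem g hg =>
      obtain ⟨φ, rfl⟩ := hg
      exact ⟨1, -φ, fun v => by simp [hq, sub_eq_add_neg]⟩
    | zero => exact ⟨0, 0, by simp⟩
    | add g k _ _ hg hk =>
      obtain ⟨κ, ψ, hψ⟩ := hg
      obtain ⟨μ, χ, hχ⟩ := hk
      exact ⟨κ + μ, ψ + χ, fun v => by
        rw [Pi.add_apply, hψ, hχ, LinearMap.add_apply]; ring⟩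
    | smul a g _ hg =>
      obtain ⟨κ, ψ, hψ⟩ := hg
      exact ⟨a * κ, a • ψ, fun v => by
        rw [Pi.smul_apply, hψ, LinearMap.smul_apply, smul_eq_mul, smul_eq_mul, mul_add]⟩
  have hone : ∀ x : F, x ≠ 0 → x = 1 := fun x hx => by
    simpa [hq] using FiniteField.pow_card_sub_one_eq_one x hx
  have h1 := hone _ hF.apply_left_ne_zero
  have h2 := hone _ hF.apply_right_ne_zero
  have h3 := hone _ hF.apply_add_ne_zero
  rw [hfg _ hF.left_ne_zero, hψ] at h1
  rw [hfg _ hF.right_ne_zero, hψ] at h2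
  rw [hfg _ hF.add_ne_zero, hψ, map_add] at h3
  have hle := hF.le_ker hl (ψ := ψ) (by linear_combination h3 - h2) (by linear_combination h3 - h1)
  obtain ⟨d, hd, hd0⟩ := exists_map_eq_zero_notMem h4 hl ψ
  have hle' : l ⊔ F ∙ d ≤ LinearMap.ker ψ :=
    sup_le hle ((Submodule.span_singleton_le_iff_mem _ _).mpr hd0)
  refine ⟨d, hd, fun v hv hv0 => ?_⟩
  rw [hfg v hv0, hψ, show ψ v = 0 from hle' hv]
  linear_combination h1 + h2 - h3

theorem TriangleOn.not_constant [FiniteDimensional F V] {W : Submodule F V}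
    {φ : Fin 3 → V →ₗ[F] F} {a : Fin 3 → F} (h2 : (2 : F) = 0) (hone : ∀ x : F, x ≠ 0 → x = 1)
    (hW : Module.finrank F W = 3) (hT : TriangleOn f W φ a) :
    ¬ ∀ v ∈ W, v ≠ 0 → f v = 1 := by
  intro h
  obtain ⟨v, hv, hv0, h0, h1⟩ := exists_map_eq_zero₂ hW (φ 0) (φ 1)
  have h3 : φ 2 v ≠ 0 := fun h3 => hv0 (hT.joint v hv
    (TriangleOn.forall_fin_three (i := 0) (j := 1) (k := 2) (by decide) (by decide) (by decide)
      h0 h1 h3))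
  have := hT.eq v hv hv0
  rw [h v hv hv0, Fin.sum_univ_three, if_pos h0, if_pos h1, if_neg h3,
    hone _ (hT.ne_zero 0), hone _ (hT.ne_zero 1)] at this
  exact one_ne_zero (α := F) (by linear_combination this + h2)

theorem OddOn.not_constant [FiniteDimensional F V] {W : Submodule F V}
    {U₁ U₂ U₃ Z : V →ₗ[F] F} {a₁ a₂ a₃ b : F} (hW : Module.finrank F W = 3)
    (hO : OddOn f W U₁ U₂ U₃ Z a₁ a₂ a₃) : ¬ ∀ v ∈ W, v ≠ 0 → f v = b := by
  intro h
  obtain ⟨N, hN, hN0, hN1, hN2⟩ := exists_map_eq_zero₂ hW U₁ U₂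
  obtain ⟨v, hv, hv0, hv1, hvZ⟩ := exists_map_eq_zero₂ hW U₁ Z
  have hNZ : Z N ≠ 0 := fun h0 => hN0 (hO.joint N hN hN1 hN2 h0)
  have hv2 : U₂ v ≠ 0 := fun h0 => hv0 (hO.joint v hv hv1 h0 hvZ)
  have key : ∀ w ∈ W, U₁ w = 0 → U₂ w = U₂ v → b = Z w / U₂ v + a₁ := by
    intro w hw h1 h2
    have hw2 : U₂ w ≠ 0 := by rwa [h2]
    have hw3 : U₃ w ≠ 0 := fun h3 => hw2 (by linear_combination hO.sum_zero w - h1 - h3)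
    have hw0 : w ≠ 0 := by
      rintro rfl
      exact hw2 (map_zero _)
    rw [← h w hw hw0, hO.eq w hw hw0, if_pos h1, if_neg hw2, if_neg hw3, add_zero, add_zero, h2]
  have k1 := key v hv hv1 rfl
  have k2 := key (v + N) (W.add_mem hv hN) (by simp [hv1, hN1]) (by simp [hN2])
  rw [map_add, add_div] at k2
  exact div_ne_zero hNZ hv2 (by linear_combination k1 - k2)

section CharThree

theorem QuadraticMap.parallelogram (Q : QuadraticMap F V F) (x y : V) :
    Q (x + y) + Q (x - y) = 2 * Q x + 2 * Q y := by
  rw [QuadraticMap.map_add Q x y, sub_eq_add_neg, QuadraticMap.map_add Q x (-y),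
    QuadraticMap.map_neg, QuadraticMap.polar_neg_right]
  ring

/-- Up to a factor `-2`, the Gram determinant of the polar form. -/
def gram (Q : QuadraticMap F V F) (x y z : V) : F :=
  Q x * QuadraticMap.polar Q y z ^ 2 + Q y * QuadraticMap.polar Q x z ^ 2 +
    Q z * QuadraticMap.polar Q x y ^ 2 -
    QuadraticMap.polar Q x y * QuadraticMap.polar Q x z * QuadraticMap.polar Q y z -
    4 * Q x * Q y * Q z

theorem gram_parallelogram (h3 : (3 : F) = 0) (Q : QuadraticMap F V F) (x y z w : V) :
    gram Q x y z + gram Q x y w + gram Q x y (z + w) + gram Q x y (z - w) = 0 := by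
  have h := QuadraticMap.parallelogram Q z w
  have h0 : 3 * (gram Q x y z + gram Q x y w) = 0 := by rw [h3, zero_mul]
  simp only [gram, QuadraticMap.polar_add_right, QuadraticMap.polar_sub_right] at h0 ⊢
  linear_combination (QuadraticMap.polar Q x y ^ 2 - 4 * Q x * Q y) * h + h0

theorem det_ne_zero_of_joint {W : Submodule F V} {ψ : Fin 3 → V →ₗ[F] F}
    (hψ : ∀ v ∈ W, (∀ i, ψ i v = 0) → v = 0) {u : Fin 3 → V} (hu : ∀ i, u i ∈ W)
    (hind : LinearIndependent F u) : (Matrix.of fun i j => ψ i (u j)).det ≠ 0 := by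
  intro h
  obtain ⟨x, hx0, hx⟩ := Matrix.exists_mulVec_eq_zero_iff.mpr h
  have hsum : ∑ j, x j • u j = 0 := by
    refine hψ _ (Submodule.sum_mem _ fun j _ => W.smul_mem _ (hu j)) fun i => ?_
    have := congrFun hx i
    simp only [Matrix.mulVec, dotProduct, Matrix.of_apply, Pi.zero_apply] at this
    rw [← this, map_sum]
    exact Finset.sum_congr rfl fun j _ => by rw [map_smul, smul_eq_mul, mul_comm]
  exact hx0 (funext (Fintype.linearIndependent_iff.mp hind x hsum))

theorem SecantFrame.linearIndependent (hF : SecantFrame f l e₁ e₂) {d : V} (hd : d ∉ l) :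
    LinearIndependent F ![e₁, e₂, d] := by
  rw [Fintype.linearIndependent_iff]
  intro x hx
  rw [Fin.sum_univ_three] at hx
  simp only [Matrix.cons_val_zero, Matrix.cons_val_one, Matrix.cons_val] at hx
  have h2 : x 2 = 0 := by
    by_contra h2
    refine hd ?_
    rw [← inv_smul_smul₀ h2 d, ← neg_eq_of_add_eq_zero_right hx]
    exact l.smul_mem _ (l.neg_mem (hF.smul_add_mem _ _))
  rw [h2, zero_smul, add_zero] at hx
  obtain ⟨h0, h1⟩ := hF.indep _ _ hx
  intro i
  fin_cases i
  exacts [h0, h1, h2]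

theorem exists_quadraticMap [Fintype F] (hq : Fintype.card F = 3)
    (hg : g ∈ Submodule.span F {g : V → F | ∃ φ : V →ₗ[F] F,
      g = fun v => 1 - φ v ^ (Fintype.card F - 1)}) :
    ∃ (κ : F) (Q : QuadraticMap F V F), ∀ v, g v = κ + Q v := by
  induction hg using Submodule.span_induction with
  | mem g hg =>
    obtain ⟨φ, rfl⟩ := hg
    exact ⟨1, -QuadraticMap.linMulLin φ φ, fun v => by simp [hq]; ring⟩
  | zero => exact ⟨0, 0, by simp⟩
  | add g k _ _ hg hk =>
    obtain ⟨κ, Q, hQ⟩ := hg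
    obtain ⟨μ, R, hR⟩ := hk
    exact ⟨κ + μ, Q + R, fun v => by rw [Pi.add_apply, hQ, hR, add_apply]; ring⟩
  | smul a g _ hg =>
    obtain ⟨κ, Q, hQ⟩ := hg
    exact ⟨a * κ, a • Q, fun v => by
      rw [Pi.smul_apply, hQ, smul_apply, smul_eq_mul, smul_eq_mul, mul_add]⟩

theorem SecantFrame.const_eq_zero (h2 : (2 : F) ≠ 0) {W : Submodule F V} (hlW : l ≤ W)
    (hF : SecantFrame f l e₁ e₂) {Q : QuadraticMap F V F} {b : F}
    (h : ∀ v ∈ W, v ≠ 0 → Q v = b) : b = 0 := by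
  have h1 := hF.smul_add_mem 1 (-1)
  have h1' := hF.smul_add_ne_zero (y := 1) (z := -1) (by simp)
  rw [one_smul, neg_one_smul, ← sub_eq_add_neg] at h1 h1'
  have := QuadraticMap.parallelogram Q e₁ e₂
  rw [h _ (hlW (l.add_mem hF.mem₁ hF.mem₂)) hF.add_ne_zero, h _ (hlW h1) h1',
    h _ (hlW hF.mem₁) hF.left_ne_zero, h _ (hlW hF.mem₂) hF.right_ne_zero] at this
  exact (mul_eq_zero.mp (show 2 * b = 0 by linear_combination -this)).resolve_left h2

theorem eq_zero_of_gram [FiniteDimensional F V] (h3 : (3 : F) = 0)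
    (h4 : Module.finrank F V = 4) (hl : Module.finrank F l = 2) {Q : QuadraticMap F V F} {κ : F}
    (h : ∀ d, d ∉ l → gram Q e₁ e₂ d = -κ) : κ = 0 := by
  obtain ⟨d, d', hd, hd', hs, hs'⟩ := exists_pair_notMem h4 hl
  have := gram_parallelogram h3 Q e₁ e₂ d d'
  rw [h _ hd, h _ hd', h _ hs, h _ hs'] at this
  linear_combination -this - κ * h3

theorem TriangleOn.quadraticMap_eq (h2 : (2 : F) ≠ 0) (hsq : ∀ x : F, x ≠ 0 → x ^ 2 = 1)
    {W : Submodule F V} {φ : Fin 3 → V →ₗ[F] F} {a : Fin 3 → F} (hT : TriangleOn f W φ a)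
    (hlW : l ≤ W) (hF : SecantFrame f l e₁ e₂) {κ : F} {Q : QuadraticMap F V F}
    (hQ : ∀ v, v ≠ 0 → f v = κ + Q v) :
    κ = a 0 + a 1 + a 2 ∧
      ∀ v ∈ W, Q v = -(a 0 * φ 0 v ^ 2 + a 1 * φ 1 v ^ 2 + a 2 * φ 2 v ^ 2) := by
  have hite : ∀ x b : F, (if x = 0 then b else 0) = b - b * x ^ 2 := by
    intro x b
    split_ifs with h
    · rw [h]; ring
    · rw [hsq x h]; ring
  have key : ∀ v ∈ W, v ≠ 0 → (Q + a 0 • QuadraticMap.linMulLin (φ 0) (φ 0) +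
      a 1 • QuadraticMap.linMulLin (φ 1) (φ 1) + a 2 • QuadraticMap.linMulLin (φ 2) (φ 2)) v =
      a 0 + a 1 + a 2 - κ := by
    intro v hv hv0
    have := hT.eq v hv hv0
    simp only [hite, hQ v hv0, Fin.sum_univ_three] at this
    simp only [add_apply, smul_apply, QuadraticMap.linMulLin_apply,
      smul_eq_mul]
    linear_combination this
  have h0 := hF.const_eq_zero h2 hlW key
  refine ⟨by linear_combination -h0, fun v hv => ?_⟩
  by_cases hv0 : v = 0
  · simp [hv0]
  · have := key v hv hv0
    simp only [add_apply, smul_apply, QuadraticMap.linMulLin_apply,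
      smul_eq_mul] at this
    linear_combination this + h0

theorem OddOn.quadraticMap_eq (h3 : (3 : F) = 0) (h2 : (2 : F) ≠ 0)
    (hsq : ∀ x : F, x ≠ 0 → x ^ 2 = 1)
    {W : Submodule F V} {U₁ U₂ U₃ Z : V →ₗ[F] F} {a₁ a₂ a₃ : F}
    (hO : OddOn f W U₁ U₂ U₃ Z a₁ a₂ a₃)
    (hlW : l ≤ W) (hF : SecantFrame f l e₁ e₂) {κ : F} {Q : QuadraticMap F V F}
    (hQ : ∀ v, v ≠ 0 → f v = κ + Q v) :
    κ = a₁ + a₂ + a₃ ∧ ∀ v ∈ W, Q v = -(a₁ * U₁ v ^ 2 + a₂ * U₂ v ^ 2 + a₃ * U₃ v ^ 2) +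
      Z v * (U₃ v - U₂ v) := by
  have hinv : ∀ x : F, x ≠ 0 → x⁻¹ = x := fun x hx =>
    inv_eq_of_mul_eq_one_left (by rw [← sq, hsq x hx])
  have hval : ∀ x y z w : F, x + y + z = 0 → (if x = 0 then w / y + a₁ else 0) +
      (if y = 0 then w / z + a₂ else 0) + (if z = 0 then w / x + a₃ else 0) =
      a₁ + a₂ + a₃ - (a₁ * x ^ 2 + a₂ * y ^ 2 + a₃ * z ^ 2) + w * (z - y) := by
    intro x y z w h
    obtain rfl : z = -x - y := by linear_combination h
    by_cases hx : x = 0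
    · subst hx
      by_cases hy : y = 0
      · subst hy; simp
      · have := hsq y hy
        simp only [if_true, hy, if_false, neg_zero, zero_sub, neg_eq_zero, div_eq_mul_inv, hinv y hy]
        linear_combination (a₂ + a₃) * this + w * y * h3
    · have hx2 := hsq x hx
      by_cases hy : y = 0
      · subst hy
        simp only [hx, if_false, if_true, sub_zero, neg_eq_zero, div_eq_mul_inv, inv_neg,
          hinv x hx]
        linear_combination (a₁ + a₃) * hx2
      · have hy2 := hsq y hy
        by_cases hz : -x - y = 0
        · obtain rfl : y = -x := by linear_combination -hz
          simp only [hx, hy, hz, if_false, if_true, div_eq_mul_inv, hinv x hx]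
          linear_combination (a₁ + a₂) * hx2
        · have hz2 := hsq _ hz
          have hxy : y = x := by
            have h0 : (y - x) ^ 2 = 0 := by
              linear_combination 2 * hx2 + 2 * hy2 - hz2 + h3
            exact sub_eq_zero.mp (pow_eq_zero_iff two_ne_zero |>.mp h0)
          simp only [hx, hy, hz, if_false]
          subst hxy
          linear_combination (a₁ + a₂ + a₃) * hx2 + (a₃ * y ^ 2 + w * y) * h3
  have key : ∀ v ∈ W, v ≠ 0 → (Q + a₁ • QuadraticMap.linMulLin U₁ U₁ +
      a₂ • QuadraticMap.linMulLin U₂ U₂ + a₃ • QuadraticMap.linMulLin U₃ U₃ -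
      QuadraticMap.linMulLin Z (U₃ - U₂)) v = a₁ + a₂ + a₃ - κ := by
    intro v hv hv0
    have := hO.eq v hv hv0
    rw [hval _ _ _ _ (hO.sum_zero v), hQ v hv0] at this
    simp only [add_apply, smul_apply, QuadraticMap.linMulLin_apply,
      sub_apply, LinearMap.sub_apply, smul_eq_mul]
    linear_combination this
  have h0 := hF.const_eq_zero h2 hlW key
  refine ⟨by linear_combination -h0, fun v hv => ?_⟩
  by_cases hv0 : v = 0
  · simp [hv0]
  · have := key v hv hv0
    simp only [add_apply, smul_apply, QuadraticMap.linMulLin_apply,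
      sub_apply, LinearMap.sub_apply, smul_eq_mul] at this
    linear_combination this + h0

end CharThree

end Pencils

section OrderThree

variable {V : Type*} [AddCommGroup V] [Module F V] {f g : V → F} {l : Submodule F V} {e₁ e₂ : V}

theorem three_eq_zero [Fintype F] (hq : Fintype.card F = 3) : (3 : F) = 0 := by
  have := FiniteField.cast_card_eq_zero F
  rw [hq] at this
  exact_mod_cast this

theorem two_ne_zero_of_three_eq_zero (h3 : (3 : F) = 0) : (2 : F) ≠ 0 := fun h2 =>
  one_ne_zero (α := F) (by linear_combination h3 - h2)

theorem sq_eq_one_of_card_eq_three [Fintype F] (hq : Fintype.card F = 3) {x : F} (hx : x ≠ 0) :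
    x ^ 2 = 1 := by
  simpa [hq] using FiniteField.pow_card_sub_one_eq_one x hx

theorem eq_of_add_add_eq_zero (h3 : (3 : F) = 0) (hsq : ∀ x : F, x ≠ 0 → x ^ 2 = 1) {x y z : F}
    (hx : x ≠ 0) (hy : y ≠ 0) (hz : z ≠ 0) (h : x + y + z = 0) : x = y ∧ y = z := by
  have key : ∀ {x y z : F}, x ≠ 0 → y ≠ 0 → z ≠ 0 → x + y + z = 0 → x = y := by
    intro x y z hx hy hz h
    refine sub_eq_zero.mp (pow_eq_zero_iff two_ne_zero |>.mp ?_)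
    linear_combination 2 * hsq x hx + 2 * hsq y hy - hsq z hz - (x + y - z) * h + h3
  exact ⟨key hx hy hz h, key hy hz hx (by linear_combination h)⟩

theorem TriangleOn.gram_eq (hsq : ∀ x : F, x ≠ 0 → x ^ 2 = 1) {W : Submodule F V}
    {φ : Fin 3 → V →ₗ[F] F} {a : Fin 3 → F} (hT : TriangleOn f W φ a) {Q : QuadraticMap F V F}
    (hQ : ∀ v ∈ W, Q v = -(a 0 * φ 0 v ^ 2 + a 1 * φ 1 v ^ 2 + a 2 * φ 2 v ^ 2)) {u : Fin 3 → V}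
    (hu : ∀ i, u i ∈ W) (hind : LinearIndependent F u) :
    gram Q (u 0) (u 1) (u 2) = 4 * (a 0 * a 1 * a 2) := by
  have hdet := hsq _ (det_ne_zero_of_joint hT.joint hu hind)
  rw [Matrix.det_fin_three] at hdet
  simp only [Matrix.of_apply] at hdet
  simp only [gram, QuadraticMap.polar, hQ _ (W.add_mem (hu _) (hu _)), hQ _ (hu _), map_add]
  linear_combination 4 * (a 0 * a 1 * a 2) * hdet

theorem OddOn.gram_eq (hsq : ∀ x : F, x ≠ 0 → x ^ 2 = 1) {W : Submodule F V}
    {U₁ U₂ U₃ Z : V →ₗ[F] F} {a₁ a₂ a₃ : F} (hO : OddOn f W U₁ U₂ U₃ Z a₁ a₂ a₃)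
    {Q : QuadraticMap F V F}
    (hQ : ∀ v ∈ W, Q v = -(a₁ * U₁ v ^ 2 + a₂ * U₂ v ^ 2 + a₃ * U₃ v ^ 2) +
      Z v * (U₃ v - U₂ v)) {u : Fin 3 → V}
    (hu : ∀ i, u i ∈ W) (hind : LinearIndependent F u) :
    gram Q (u 0) (u 1) (u 2) = -(4 * a₁ + a₂ + a₃) := by
  have hU : ∀ v, U₁ v = -U₂ v - U₃ v := fun v => by linear_combination hO.sum_zero v
  have hdet := hsq _ (det_ne_zero_of_joint (ψ := ![U₂, U₃, Z]) (fun v hv h => by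
    have h2 : U₂ v = 0 := h 0
    have h3 : U₃ v = 0 := h 1
    exact hO.joint v hv (by rw [hU, h2, h3, neg_zero, sub_zero]) h2 (h 2)) hu hind)
  rw [Matrix.det_fin_three] at hdet
  simp only [Matrix.of_apply, Matrix.cons_val_zero, Matrix.cons_val_one, Matrix.cons_val] at hdet
  simp only [gram, QuadraticMap.polar, hQ _ (W.add_mem (hu _) (hu _)), hQ _ (hu _), hU, map_add]
  linear_combination -(4 * a₁ + a₂ + a₃) * hdet

theorem SecantFrame.vec_mem (hF : SecantFrame f l e₁ e₂) (d : V) (i : Fin 3) :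
    ![e₁, e₂, d] i ∈ l ⊔ F ∙ d := by
  fin_cases i
  exacts [Submodule.mem_sup_left hF.mem₁, Submodule.mem_sup_left hF.mem₂,
    mem_sup_span_singleton l d]

theorem no_triangle_pencil_of_card_eq_three [Fintype F] [FiniteDimensional F V]
    (hq : Fintype.card F = 3) (h4 : Module.finrank F V = 4) (hl : Module.finrank F l = 2)
    (hg : g ∈ Submodule.span F {g : V → F | ∃ φ : V →ₗ[F] F,
      g = fun v => 1 - φ v ^ (Fintype.card F - 1)}) (hfg : ∀ v, v ≠ 0 → f v = g v)
    (hF : SecantFrame f l e₁ e₂) (hT : ∀ d, d ∉ l → ∃ φ a, TriangleOn f (l ⊔ F ∙ d) φ a) :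
    False := by
  have h3 := three_eq_zero hq
  have h2 := two_ne_zero_of_three_eq_zero h3
  have hsq : ∀ x : F, x ≠ 0 → x ^ 2 = 1 := fun x hx => sq_eq_one_of_card_eq_three hq hx
  obtain ⟨κ, Q, hQ⟩ := exists_quadraticMap hq hg
  have hfQ : ∀ v, v ≠ 0 → f v = κ + Q v := fun v hv => (hfg v hv).trans (hQ v)
  have hκ : κ = 0 := by
    by_contra hκ
    refine hκ (eq_zero_of_gram h3 h4 hl (Q := Q) (e₁ := e₁) (e₂ := e₂) fun d hd => ?_)
    obtain ⟨φ, a, hφ⟩ := hT d hd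
    obtain ⟨hs, hφQ⟩ := hφ.quadraticMap_eq h2 hsq le_sup_left hF hfQ
    refine (hφ.gram_eq hsq hφQ (hF.vec_mem d) (hF.linearIndependent hd)).trans ?_
    have h0 := hsq _ (hφ.ne_zero 0)
    have h1 := hsq _ (hφ.ne_zero 1)
    have h2' := hsq _ (hφ.ne_zero 2)
    have hk := hsq _ hκ
    obtain ⟨σ, hσ⟩ : ∃ σ, σ = a 0 * a 1 + a 0 * a 2 + a 1 * a 2 := ⟨_, rfl⟩
    have hσ1 : σ = -1 := mul_left_cancel₀ h2 (by
      rw [hs] at hk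
      linear_combination 2 * hσ + hk - h0 - h1 - h2')
    have hπ : a 0 * a 1 * a 2 * κ = σ := by
      rw [hs]
      linear_combination a 1 * a 2 * h0 + a 0 * a 2 * h1 + a 0 * a 1 * h2' - hσ
    linear_combination a 0 * a 1 * a 2 * h3 - a 0 * a 1 * a 2 * hk + κ * hπ + κ * hσ1
  subst hκ
  obtain ⟨Λ₁, hΛ₁⟩ := hF.exists_moment (m := 2) (n := 1) (by omega) (by omega)
    le_rfl (by omega) hg hfg
  obtain ⟨Λ₂, hΛ₂⟩ := hF.exists_moment (m := 1) (n := 2) (by omega) le_rfl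
    (by omega) (by omega) hg hfg
  obtain ⟨d, hd, hd0⟩ := exists_map_eq_zero_notMem h4 hl (Λ₁ - Λ₂)
  obtain ⟨φ, a, hφ⟩ := hT d hd
  obtain ⟨ha, -⟩ := hφ.quadraticMap_eq h2 hsq le_sup_left hF hfQ
  obtain ⟨h01, h12⟩ := eq_of_add_add_eq_zero h3 hsq (hφ.ne_zero 0) (hφ.ne_zero 1) (hφ.ne_zero 2)
    ha.symm
  obtain ⟨s₁, s₂, s₃, hs, hb, hp⟩ := hφ.exists_normal_form hF le_sup_left
    (mem_sup_span_singleton l d) hd (hφ.side_of_card_eq_three h2 hF le_sup_left (b := a 2)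
      fun i => by fin_cases i; exacts [h01.trans h12, h12, rfl])
  rw [Fin.sum_univ_three, ← ha] at hb
  obtain ⟨hb12, hb23⟩ := eq_of_add_add_eq_zero h3 hsq hF.apply_left_ne_zero hF.apply_right_ne_zero
    hF.apply_add_ne_zero hb
  have m₁ := hΛ₁ d hd
  have m₂ := hΛ₂ d hd
  have hsum : ∑ x : F, x ^ 2 = -1 := by simpa [hq] using sum_pow_card_sub_one_eq (F := F)
  simp_rw [hp] at m₁ m₂
  rw [triangle_moment (by omega) (by omega) (by omega), hsum] at m₁
  rw [triangle_moment (by omega) (by omega) (by omega), hsum] at m₂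
  simp only [pow_one, sum_id_eq_zero (F := F) hq.ge, hb12, hb23] at m₁ m₂
  rw [LinearMap.sub_apply, ← m₁, ← m₂] at hd0
  refine mul_ne_zero hF.apply_add_ne_zero hs ?_
  push_cast at hd0
  linear_combination hd0

theorem oddPattern_eq_of_card_eq_three [Fintype F] (hq : Fintype.card F = 3)
    (b s₁ s₂ γ y z : F) : oddPattern b b b s₁ s₂ γ y z =
      b * (y - s₂ + (z - s₁)) ^ 2 + γ * (y - s₂ + (z - s₁)) := by
  have h3 := three_eq_zero hq
  have hsq : ∀ x : F, x ≠ 0 → x ^ 2 = 1 := fun x hx => sq_eq_one_of_card_eq_three hq hx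
  have hinv : ∀ x : F, x ≠ 0 → x⁻¹ = x := fun x hx =>
    inv_eq_of_mul_eq_one_left (by rw [← sq, hsq x hx])
  have hz : z = s₁ ↔ z - s₁ = 0 := sub_eq_zero.symm
  have hy : y = s₂ ↔ y - s₂ = 0 := sub_eq_zero.symm
  unfold oddPattern
  rw [if_congr hz rfl rfl, if_congr hy rfl rfl]
  generalize y - s₂ = w
  generalize z - s₁ = x
  by_cases hw0 : w = 0
  · subst hw0
    by_cases hx0 : x = 0
    · simp [hx0]
      linear_combination b * h3
    · simp only [hx0, Ne.symm hx0, if_true, if_false, div_eq_mul_inv, hinv x hx0]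
      linear_combination -b * hsq x hx0
  · have hw2 := hsq w hw0
    by_cases hx0 : x = 0
    · subst hx0
      simp only [hw0, if_true, if_false, div_eq_mul_inv, hinv w hw0]
      linear_combination -b * hw2
    · have hx2 := hsq x hx0
      by_cases hwx : w = x
      · subst hwx
        simp only [hw0, if_true, if_false, div_eq_mul_inv, hinv w hw0]
        linear_combination -4 * b * hw2 - (b + γ * w) * h3
      · have hwx' : w + x = 0 := by
          refine (mul_eq_zero.mp ?_).resolve_left (sub_ne_zero.mpr hwx)
          linear_combination hw2 - hx2
        simp only [hw0, hx0, hwx, if_false, hwx']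
        ring

theorem no_odd_pencil_of_card_eq_three [Fintype F] [FiniteDimensional F V]
    (hq : Fintype.card F = 3) (h4 : Module.finrank F V = 4) (hl : Module.finrank F l = 2)
    (hg : g ∈ Submodule.span F {g : V → F | ∃ φ : V →ₗ[F] F,
      g = fun v => 1 - φ v ^ (Fintype.card F - 1)}) (hfg : ∀ v, v ≠ 0 → f v = g v)
    (hF : SecantFrame f l e₁ e₂)
    (hO : ∀ d, d ∉ l → ∃ U₁ U₂ U₃ Z a₁ a₂ a₃, OddOn f (l ⊔ F ∙ d) U₁ U₂ U₃ Z a₁ a₂ a₃) :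
    False := by
  have h3 := three_eq_zero hq
  have h2 := two_ne_zero_of_three_eq_zero h3
  have hsq : ∀ x : F, x ≠ 0 → x ^ 2 = 1 := fun x hx => sq_eq_one_of_card_eq_three hq hx
  obtain ⟨κ, Q, hQ⟩ := exists_quadraticMap hq hg
  have hfQ : ∀ v, v ≠ 0 → f v = κ + Q v := fun v hv => (hfg v hv).trans (hQ v)
  have hκ : κ = 0 := by
    refine eq_zero_of_gram h3 h4 hl (Q := Q) (e₁ := e₁) (e₂ := e₂) fun d hd => ?_
    obtain ⟨U₁, U₂, U₃, Z, a₁, a₂, a₃, hU⟩ := hO d hd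
    obtain ⟨hs, hUQ⟩ := hU.quadraticMap_eq h3 h2 hsq le_sup_left hF hfQ
    refine (hU.gram_eq hsq hUQ (hF.vec_mem d) (hF.linearIndependent hd)).trans ?_
    linear_combination hs - a₁ * h3
  subst hκ
  simp only [zero_add] at hfQ
  have key : ∀ d, d ∉ l → QuadraticMap.polar Q e₁ d ^ 2 - Q e₁ * Q d = 1 := by
    intro d hd
    obtain ⟨U₁, U₂, U₃, Z, a₁, a₂, a₃, hU⟩ := hO d hd
    obtain ⟨ha, -⟩ := hU.quadraticMap_eq h3 h2 hsq le_sup_left hF (κ := 0) (by simpa using hfQ)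
    obtain ⟨s₁, s₂, γ, hγ, hb, hp⟩ := hU.exists_normal_form hF le_sup_left
      (mem_sup_span_singleton l d) hd (hU.side_of_card_eq_three hq hF le_sup_left ha.symm)
      (hU.rotate.side_of_card_eq_three hq hF le_sup_left (by linear_combination -ha))
      (hU.rotate.rotate.side_of_card_eq_three hq hF le_sup_left (by linear_combination -ha))
    rw [← ha] at hb
    obtain ⟨hb12, hb23⟩ := eq_of_add_add_eq_zero h3 hsq hF.apply_left_ne_zero
      hF.apply_right_ne_zero hF.apply_add_ne_zero hb
    rw [← hb23, ← hb12] at hp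
    simp only [oddPattern_eq_of_card_eq_three hq] at hp
    have p0 := hp 0 0
    have p1 := hp 1 0
    rw [hfQ _ (hF.smul_add_add_ne_zero hd _ _), hfQ _ hF.left_ne_zero] at p0 p1
    simp only [zero_smul, one_smul, add_zero, zero_add] at p0 p1
    have hL : QuadraticMap.polar Q e₁ d = Q e₁ * (s₁ + s₂) + γ := by
      rw [QuadraticMap.polar]
      linear_combination p1 - p0 - Q e₁ * (s₁ + s₂) * h3
    rw [hL]
    linear_combination hsq γ hγ - Q e₁ * p0 + Q e₁ * (s₁ + s₂) * γ * h3
  obtain ⟨d, d', hd, hd', hs, hs'⟩ := exists_pair_notMem h4 hl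
  have hpar := QuadraticMap.parallelogram Q d d'
  have k₃ := key _ hs
  have k₄ := key _ hs'
  rw [QuadraticMap.polar_add_right] at k₃
  rw [QuadraticMap.polar_sub_right] at k₄
  refine one_ne_zero (α := F) ?_
  linear_combination (QuadraticMap.polar Q e₁ d ^ 2 + QuadraticMap.polar Q e₁ d' ^ 2 -
    Q e₁ * (Q d + Q d') - 1) * h3 - Q e₁ * hpar - key d hd - key d' hd' - k₃ - k₄

end OrderThree

theorem no_triangle_pencil [Fintype F] {p q : ℕ} [Fact p.Prime] (ι : ZMod p →+* F)
    (hF : Fintype.card F = q) (hq4 : q ≠ 4) {c : Pt F 3 → ZMod p} (hc : c ∈ code F p 3)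
    {l : Submodule F (Fin (3 + 1) → F)} (hl : secant c l 3)
    (hT : ∀ W : Submodule F (Fin (3 + 1) → F), IsPlane W → l ≤ W → TypeTri p c W) : False := by
  have h4 : Module.finrank F (Fin (3 + 1) → F) = 4 := by simp
  obtain ⟨g, hg, hfg⟩ := exists_span_of_mem_code ι hc
  obtain ⟨e₁, e₂, hfr⟩ := hl.exists_frame ι
  have hT' : ∀ d, d ∉ l → ∃ φ a, TriangleOn (liftVec ι c) (l ⊔ F ∙ d) φ a := fun d hd =>
    have hW : IsPlane (l ⊔ F ∙ d) := finrank_sup_span_singleton hl.1 hd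
    (hT _ hW le_sup_left).exists_triangleOn ι hW
  have h1 : 1 < Fintype.card F := Fintype.one_lt_card
  obtain h2 | h3 | h5 : Fintype.card F = 2 ∨ Fintype.card F = 3 ∨ 5 ≤ Fintype.card F := by omega
  · obtain ⟨d, hd, hconst⟩ := hfr.exists_constant h2 h4 hl.1 hg hfg
    obtain ⟨φ, a, hφ⟩ := hT' d hd
    refine hφ.not_constant ?_ (fun x hx => ?_) (finrank_sup_span_singleton hl.1 hd) hconst
    · have := FiniteField.cast_card_eq_zero F
      rw [h2] at this
      exact_mod_cast this
    · simpa [h2] using FiniteField.pow_card_sub_one_eq_one x hx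
  · exact no_triangle_pencil_of_card_eq_three h3 h4 hl.1 hg hfg hfr hT'
  · exact no_triangle_pencil_of_five_le h5 h4 hl.1 hg hfg hfr hT'

theorem no_odd_pencil [Fintype F] {p : ℕ} [Fact p.Prime] (ι : ZMod p →+* F)
    (hF : Fintype.card F = p) {c : Pt F 3 → ZMod p} (hc : c ∈ code F p 3)
    {l : Submodule F (Fin (3 + 1) → F)} (hl : secant c l 3)
    (hO : ∀ W : Submodule F (Fin (3 + 1) → F), IsPlane W → l ≤ W → TypeOdd p c W) : False := by
  have h4 : Module.finrank F (Fin (3 + 1) → F) = 4 := by simp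
  have hp : p.Prime := Fact.out
  obtain ⟨g, hg, hfg⟩ := exists_span_of_mem_code ι hc
  obtain ⟨e₁, e₂, hfr⟩ := hl.exists_frame ι
  have hO' : ∀ d, d ∉ l → ∃ U₁ U₂ U₃ Z a₁ a₂ a₃,
      OddOn (liftVec ι c) (l ⊔ F ∙ d) U₁ U₂ U₃ Z a₁ a₂ a₃ := fun d hd =>
    (hO _ (finrank_sup_span_singleton hl.1 hd) le_sup_left).exists_oddOn ι
  have hp4 : p ≠ 4 := by
    rintro rfl
    exact absurd hp (by decide)
  have hp2 := hp.two_le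
  obtain h2 | h3 | h5 : p = 2 ∨ p = 3 ∨ 5 ≤ p := by omega
  · obtain ⟨d, hd, hconst⟩ := hfr.exists_constant (hF.trans h2) h4 hl.1 hg hfg
    obtain ⟨U₁, U₂, U₃, Z, a₁, a₂, a₃, hU⟩ := hO' d hd
    exact hU.not_constant (finrank_sup_span_singleton hl.1 hd) hconst
  · exact no_odd_pencil_of_card_eq_three (hF.trans h3) h4 hl.1 hg hfg hfr hO'
  · refine no_odd_pencil_of_five_le (hF ▸ h5) ?_ h4 hl.1 hg hfg hfr hO'
    have h20 : (2 : ZMod p) ≠ 0 := fun h => by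
      have := Nat.le_of_dvd two_pos
        ((ZMod.natCast_eq_zero_iff 2 p).mp (by exact_mod_cast h))
      omega
    rwa [← map_ofNat ι 2, map_ne_zero]

/-- Lemma 24 of the paper: in `PG(3,q)`, for a code word of weight between
`3q²-3q-3` and `B_{3,q}`, no `3`-secant lies in `q+1` planes (i.e. all planes through it) of
one same type `T ∈ {T^odd, T^△}`. -/
theorem statement13 [Fintype F] {p h q : ℕ} [Fact p.Prime] (hh : 1 ≤ h) (hq : q = p ^ h)
    (hF : Fintype.card F = q)
    (c : Pt F 3 → ZMod p) (hc : c ∈ code F p 3)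
    (hlow : 3 * q ^ 2 - 3 * q - 3 ≤ wt c) (hwt : (wt c : ℝ) ≤ B 3 q) :
    ¬ ∃ (l : Submodule F (Fin (3 + 1) → F)) (t : PlaneT), secant c l 3 ∧
        (t = PlaneT.Todd ∨ t = PlaneT.Ttri) ∧
        ∀ W : Submodule F (Fin (3 + 1) → F), IsPlane W → l ≤ W →
          PlaneIsType p q c W t := by
  rintro ⟨l, t, hl, ht, hall⟩
  have : CharP F p := charP_of_card_eq_prime_pow (hF.trans hq)
  let ι : ZMod p →+* F := ZMod.castHom dvd_rfl F
  rcases ht with rfl | rfl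
  · obtain ⟨d, hd⟩ : ∃ d, d ∉ l := by
      obtain ⟨d, hd, -⟩ := exists_map_eq_zero_notMem (V := Fin (3 + 1) → F) (by simp) hl.1 0
      exact ⟨d, hd⟩
    have hp := (hall _ (finrank_sup_span_singleton hl.1 hd) le_sup_left).1
    exact no_odd_pencil ι hp hc hl hall
  · refine no_triangle_pencil ι hF ?_ hc hl hall
    rintro rfl
    norm_num [B] at hwt
    omega

end PGCode
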